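/- Completeness of the nominal anti-unification algorithm 𝔑: Let t and s be nominal terms of the same sort and ∇, Γ freshness contexts, all based on a finite set of atoms A. If ⟨Γ, r⟩ is an A-based generalization of ⟨∇, t⟩ and ⟨∇, s⟩, then there exists a derivation {X : t ≜ s}; ∅; ∅; ε ⟹⁺ ∅; S; Γ'; σ obtained by an execution of 𝔑 (with global parameters A and ∇) such that ⟨Γ, r⟩ ⪯ ⟨Γ', Xσ⟩. -/

import Mathlib

set_option maxHeartbeats 1000000
abbrev Atom := ℕ
abbrev Var := ℕ
abbrev Fn := ℕ
abbrev NPerm := List (Atom × Atom)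
def swapAtom (a b c : Atom) : Atom := if c = a then b else if c = b then a else c
def permAtom : NPerm → Atom → Atom
  | [], c => c
  | (a, b) :: π, c => swapAtom a b (permAtom π c)
def permInv (π : NPerm) : NPerm := π.reverse
inductive NTerm where
  | app : Fn → List NTerm → NTerm
  | atom : Atom → NTerm
  | abs : Atom → NTerm → NTerm
  | susp : NPerm → Var → NTerm

def permTerm (π : NPerm) : NTerm → NTerm
  | .app f ts => .app f (ts.attach.map (fun x => permTerm π x.1))
  | .atom a => .atom (permAtom π a)
  | .abs a t => .abs (permAtom π a) (permTerm π t)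
  | .susp ρ X => .susp (π ++ ρ) X
decreasing_by
  all_goals (simp_wf; try omega)
  all_goals (have := List.sizeOf_lt_of_mem x.2; omega)

/-- Substitutions (total maps from variables to terms; identity almost everywhere
is not required for the statements). -/
abbrev NSubst := Var → NTerm

def idSubst : NSubst := fun X => .susp [] X

/-- Application of a substitution to a term (allowing atom capture and forcing
suspended permutations). -/
def substTerm (σ : NSubst) : NTerm → NTerm
  | .app f ts => .app f (ts.attach.map (fun x => substTerm σ x.1))
  | .atom a => .atom a
  | .abs a t => .abs a (substTerm σ t)
  | .susp π X => permTerm π (σ X)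
decreasing_by
  all_goals (simp_wf; try omega)
  all_goals (have := List.sizeOf_lt_of_mem x.2; omega)

/-- Composition of substitutions: `t (σθ) = (tσ)θ`. -/
def substComp (σ θ : NSubst) : NSubst := fun X => substTerm θ (σ X)

/-- Freshness contexts: finite sets of constraints `a # X`. -/
abbrev FCtx := Finset (Atom × Var)

/-- The freshness relation `Δ ⊢ a # t` (Urban–Pitts–Gabbay rules), stated for an
arbitrary set of freshness constraints. -/
inductive NFresh (Δ : Set (Atom × Var)) : Atom → NTerm → Prop
  | atom {a b : Atom} : a ≠ b → NFresh Δ a (.atom b)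
  | susp {a : Atom} {π : NPerm} {X : Var} :
      (permAtom (permInv π) a, X) ∈ Δ → NFresh Δ a (.susp π X)
  | app {a : Atom} {f : Fn} {ts : List NTerm} :
      (∀ t ∈ ts, NFresh Δ a t) → NFresh Δ a (.app f ts)
  | abs1 {a : Atom} {t : NTerm} : NFresh Δ a (.abs a t)
  | abs2 {a b : Atom} {t : NTerm} : a ≠ b → NFresh Δ a t → NFresh Δ a (.abs b t)

/-- The α-equivalence relation `Δ ⊢ t ≈ s` (Urban–Pitts–Gabbay rules). -/
inductive NAlpha (Δ : Set (Atom × Var)) : NTerm → NTerm → Prop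
  | atom (a : Atom) : NAlpha Δ (.atom a) (.atom a)
  | abs1 {a : Atom} {t t' : NTerm} : NAlpha Δ t t' → NAlpha Δ (.abs a t) (.abs a t')
  | abs2 {a b : Atom} {t t' : NTerm} : a ≠ b → NAlpha Δ t (permTerm [(a, b)] t') →
      NFresh Δ a t' → NAlpha Δ (.abs a t) (.abs b t')
  | susp {π π' : NPerm} {X : Var} :
      (∀ a : Atom, permAtom π a ≠ permAtom π' a → (a, X) ∈ Δ) →
      NAlpha Δ (.susp π X) (.susp π' X)
  | app {f : Fn} {ts ss : List NTerm} : ts.length = ss.length →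
      (∀ p ∈ List.zip ts ss, NAlpha Δ p.1 p.2) →
      NAlpha Δ (.app f ts) (.app f ss)

/-- `FA⁻ˢ(t)`: atoms occurring freely in `t`, ignoring suspensions. -/
def FAnoSusp : NTerm → Finset Atom
  | .app _ ts => (ts.attach.map (fun x => FAnoSusp x.1)).foldr (· ∪ ·) ∅
  | .atom a => {a}
  | .abs a t => FAnoSusp t \ {a}
  | .susp _ _ => ∅
decreasing_by
  all_goals (simp_wf; try omega)
  all_goals (have := List.sizeOf_lt_of_mem x.2; omega)

/-- A substitution respects a freshness context. -/
def Respects (σ : NSubst) (Δ : FCtx) : Prop :=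
  ∀ a X, (a, X) ∈ Δ → a ∉ FAnoSusp (σ X)

/-! ### The algorithm FC -/

/-- A finite set of atomic freshness formulas `a # t`. -/
abbrev FProb := Multiset (Atom × NTerm)

/-- One step of the algorithm FC, transforming pairs `(F; Δ)`. -/
inductive FCStep : FProb × FCtx → FProb × FCtx → Prop
  | del {a b : Atom} {F : FProb} {Δ : FCtx} : a ≠ b →
      FCStep ((a, .atom b) ::ₘ F, Δ) (F, Δ)
  | abs1 {a : Atom} {t : NTerm} {F : FProb} {Δ : FCtx} :
      FCStep ((a, .abs a t) ::ₘ F, Δ) (F, Δ)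
  | abs2 {a b : Atom} {t : NTerm} {F : FProb} {Δ : FCtx} : a ≠ b →
      FCStep ((a, .abs b t) ::ₘ F, Δ) ((a, t) ::ₘ F, Δ)
  | dec {a : Atom} {f : Fn} {ts : List NTerm} {F : FProb} {Δ : FCtx} :
      FCStep ((a, .app f ts) ::ₘ F, Δ) (↑(ts.map (fun t => (a, t))) + F, Δ)
  | sus {a : Atom} {π : NPerm} {X : Var} {F : FProb} {Δ : FCtx} :
      FCStep ((a, .susp π X) ::ₘ F, Δ) (F, insert (permAtom (permInv π) a, X) Δ)

/-- The algorithm FC succeeds on `F` with result `Γ`. -/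
def FCReaches (F : FProb) (Γ : FCtx) : Prop :=
  Relation.ReflTransGen FCStep (F, ∅) (0, Γ)

/-- The algorithm FC fails on `F` (reaches a stuck state with remaining formulas). -/
def FCFails (F : FProb) : Prop :=
  ∃ st : FProb × FCtx, Relation.ReflTransGen FCStep (F, ∅) st ∧ st.1 ≠ 0 ∧
    ∀ st', ¬ FCStep st st'

/-- The freshness problem `{a # Xσ | a#X ∈ Δ}` defining the instance `Δσ`. -/
def ctxSubstProb (Δ : FCtx) (σ : NSubst) : FProb :=
  Δ.val.map (fun c => (c.1, σ c.2))

/-! ### Terms-in-context and the subsumption order -/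

/-- A term-in-context. -/
abbrev TIC := FCtx × NTerm

/-- `p ⪯ q`: the term-in-context `p` is more general than `q`.  (The condition
`p.1 σ ⊆ q.1` is expressed, equivalently by the properties of FC, as
`q.1 ⊢ a # Xσ` for all `a # X ∈ p.1`.) -/
def TIC.Le (p q : TIC) : Prop :=
  ∃ σ : NSubst, Respects σ p.1 ∧
    (∀ c ∈ p.1, NFresh (↑q.1 : Set (Atom × Var)) c.1 (σ c.2)) ∧
    NAlpha (↑q.1 : Set (Atom × Var)) (substTerm σ p.2) q.2

/-- The strict part of `⪯`. -/
def TIC.Lt (p q : TIC) : Prop := TIC.Le p q ∧ ¬ TIC.Le q p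

/-- Equi-generality `≃`. -/
def TIC.Equiv (p q : TIC) : Prop := TIC.Le p q ∧ TIC.Le q p

/-- `r` is a generalization of `p₁` and `p₂`. -/
def IsGen (r p₁ p₂ : TIC) : Prop := TIC.Le r p₁ ∧ TIC.Le r p₂

/-! ### Atoms, variables, basedness -/

def permAtoms : NPerm → Finset Atom
  | [] => ∅
  | (a, b) :: π => insert a (insert b (permAtoms π))

def termAtoms : NTerm → Finset Atom
  | .app _ ts => (ts.attach.map (fun x => termAtoms x.1)).foldr (· ∪ ·) ∅
  | .atom a => {a}
  | .abs a t => insert a (termAtoms t)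
  | .susp π _ => permAtoms π
decreasing_by
  all_goals (simp_wf; try omega)
  all_goals (have := List.sizeOf_lt_of_mem x.2; omega)

def termVars : NTerm → Finset Var
  | .app _ ts => (ts.attach.map (fun x => termVars x.1)).foldr (· ∪ ·) ∅
  | .atom _ => ∅
  | .abs _ t => termVars t
  | .susp _ X => {X}
decreasing_by
  all_goals (simp_wf; try omega)
  all_goals (have := List.sizeOf_lt_of_mem x.2; omega)

/-- `FA(t)`: the atoms occurring freely in `t` (with `FA(π·X) = Atoms(π)`). -/
def termFA : NTerm → Finset Atom
  | .app _ ts => (ts.attach.map (fun x => termFA x.1)).foldr (· ∪ ·) ∅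
  | .atom a => {a}
  | .abs a t => termFA t \ {a}
  | .susp π _ => permAtoms π
decreasing_by
  all_goals (simp_wf; try omega)
  all_goals (have := List.sizeOf_lt_of_mem x.2; omega)

def ctxAtoms (Δ : FCtx) : Finset Atom := Δ.image Prod.fst
def ctxVars (Δ : FCtx) : Finset Var := Δ.image Prod.snd

def permBased (π : NPerm) (A : Finset Atom) : Prop := permAtoms π ⊆ A
def termBased (t : NTerm) (A : Finset Atom) : Prop := termAtoms t ⊆ A
def ctxBased (Δ : FCtx) (A : Finset Atom) : Prop := ctxAtoms Δ ⊆ A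
def ticBased (p : TIC) (A : Finset Atom) : Prop := ctxBased p.1 A ∧ termBased p.2 A

/-- The number of abstraction occurrences in a term. -/
def absCount : NTerm → ℕ
  | .app _ ts => (ts.attach.map (fun x => absCount x.1)).sum
  | .atom _ => 0
  | .abs _ t => absCount t + 1
  | .susp _ _ => 0
decreasing_by
  all_goals (simp_wf; try omega)
  all_goals (have := List.sizeOf_lt_of_mem x.2; omega)

/-! ### The nominal anti-unification algorithm 𝔑 -/

/-- Anti-unification triple `X : t ≜ s`. -/
abbrev AUT := Var × NTerm × NTerm

/-- A state of the algorithm 𝔑: the unsolved triples `P`, the store `S`, the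
freshness context `Γ`, the substitution `σ`, and the set `V` of variables used
so far (needed to express freshness of the generated variables). -/
structure NState where
  P : Multiset AUT
  S : Multiset AUT
  Γ : FCtx
  σ : NSubst
  V : Finset Var

/-- `σ{X ↦ u}`. -/
def updSubst (σ : NSubst) (X : Var) (u : NTerm) : NSubst :=
  substComp σ (fun Z => if Z = X then u else .susp [] Z)

/-- The head of a term (a function symbol together with its arity, an atom, the
abstraction operator, or a variable). -/
inductive NHead where
  | fn : Fn → ℕ → NHead
  | atom : Atom → NHead
  | abs : NHead
  | var : Var → NHead
deriving DecidableEq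

def headOf : NTerm → NHead
  | .app f ts => .fn f ts.length
  | .atom a => .atom a
  | .abs _ _ => .abs
  | .susp _ X => .var X

def IsSusp : NTerm → Prop
  | .susp _ _ => True
  | _ => False

def IsAbs : NTerm → Prop
  | .abs _ _ => True
  | _ => False

/-- The applicability condition of the rule Sol. -/
def SolCond (A : Finset Atom) (Δ : FCtx) (t s : NTerm) : Prop :=
  headOf t ≠ headOf s ∨ (IsSusp t ∧ IsSusp s) ∨
    (IsAbs t ∧ IsAbs s ∧
      ¬ ∃ c ∈ A, NFresh (↑Δ : Set (Atom × Var)) c t ∧ NFresh (↑Δ : Set (Atom × Var)) c s)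

open Classical in
/-- `{a # X | a ∈ A, Δ ⊢ a # t, Δ ⊢ a # s}`. -/
noncomputable def solSet (A : Finset Atom) (Δ : FCtx) (t s : NTerm) (X : Var) : FCtx :=
  (A.filter (fun a =>
    NFresh (↑Δ : Set (Atom × Var)) a t ∧ NFresh (↑Δ : Set (Atom × Var)) a s)).image
    (fun a => (a, X))

/-- `Γ{Y ↦ π·X}` on a freshness context. -/
def ctxRename (Γ : FCtx) (Y : Var) (π : NPerm) (X : Var) : FCtx :=
  Γ.image (fun c => if c.2 = Y then (permAtom (permInv π) c.1, X) else c)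

/-- One step of the algorithm 𝔑, with global parameters `A` and `Δ`. -/
inductive NStep (A : Finset Atom) (Δ : FCtx) : NState → NState → Prop
  | decApp {X : Var} {f : Fn} {ts ss : List NTerm} {P S : Multiset AUT} {Γ : FCtx}
      {σ : NSubst} {V : Finset Var} (Ys : List Var) :
      ts.length = ss.length → Ys.length = ts.length → Ys.Nodup →
      (∀ Y ∈ Ys, Y ∉ V) →
      NStep A Δ ⟨(X, .app f ts, .app f ss) ::ₘ P, S, Γ, σ, V⟩
        ⟨↑(List.zipWith (fun Y p => (Y, p)) Ys (List.zip ts ss)) + P, S, Γ,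
         updSubst σ X (.app f (Ys.map (fun Y => .susp [] Y))), V ∪ Ys.toFinset⟩
  | decAtom {X : Var} {a : Atom} {P S : Multiset AUT} {Γ : FCtx} {σ : NSubst}
      {V : Finset Var} :
      NStep A Δ ⟨(X, .atom a, .atom a) ::ₘ P, S, Γ, σ, V⟩
        ⟨P, S, Γ, updSubst σ X (.atom a), V⟩
  | abs {X : Var} {a b : Atom} {t s : NTerm} {P S : Multiset AUT} {Γ : FCtx}
      {σ : NSubst} {V : Finset Var} (Y : Var) (c : Atom) :
      Y ∉ V → c ∈ A →
      NFresh (↑Δ : Set (Atom × Var)) c (.abs a t) →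
      NFresh (↑Δ : Set (Atom × Var)) c (.abs b s) →
      NStep A Δ ⟨(X, .abs a t, .abs b s) ::ₘ P, S, Γ, σ, V⟩
        ⟨(Y, permTerm [(c, a)] t, permTerm [(c, b)] s) ::ₘ P, S, Γ,
         updSubst σ X (.abs c (.susp [] Y)), insert Y V⟩
  | sol {X : Var} {t s : NTerm} {P S : Multiset AUT} {Γ : FCtx} {σ : NSubst}
      {V : Finset Var} :
      SolCond A Δ t s →
      NStep A Δ ⟨(X, t, s) ::ₘ P, S, Γ, σ, V⟩
        ⟨P, (X, t, s) ::ₘ S, Γ ∪ solSet A Δ t s X, σ, V⟩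
  | mer {X Y : Var} {t₁ s₁ t₂ s₂ : NTerm} {P S : Multiset AUT} {Γ : FCtx}
      {σ : NSubst} {V : Finset Var} (π : NPerm) :
      X ≠ Y →
      permBased π (termAtoms t₁ ∪ termAtoms s₁ ∪ termAtoms t₂ ∪ termAtoms s₂) →
      NAlpha (↑Δ : Set (Atom × Var)) (permTerm π t₁) t₂ →
      NAlpha (↑Δ : Set (Atom × Var)) (permTerm π s₁) s₂ →
      NStep A Δ ⟨P, (X, t₁, s₁) ::ₘ (Y, t₂, s₂) ::ₘ S, Γ, σ, V⟩
        ⟨P, (X, t₁, s₁) ::ₘ S, ctxRename Γ Y π X, updSubst σ Y (.susp π X), V⟩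

/-- The initial state of 𝔑 on the triple `X : t ≜ s`. -/
def initNState (X : Var) (t s : NTerm) (Δ : FCtx) : NState :=
  ⟨{(X, t, s)}, 0, ∅, idSubst, insert X (termVars t ∪ termVars s ∪ ctxVars Δ)⟩

/-- An `A`-based least general generalization of `p₁` and `p₂`. -/
def IsABasedLgg (A : Finset Atom) (p p₁ p₂ : TIC) : Prop :=
  ticBased p A ∧ IsGen p p₁ p₂ ∧
    ¬ ∃ p' : TIC, ticBased p' A ∧ IsGen p' p₁ p₂ ∧ TIC.Lt p p'

/-! ### The equivariance algorithm 𝔈 -/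

/-- A set of equivariance equations `t ≈ s`. -/
abbrev EProb := Multiset (NTerm × NTerm)

def eqsAtoms (E : EProb) : Finset Atom :=
  (E.map (fun e => termAtoms e.1 ∪ termAtoms e.2)).sup

def eqsVars (E : EProb) : Finset Var :=
  (E.map (fun e => termVars e.1 ∪ termVars e.2)).sup

/-- All equations of `E` are equations between atoms. -/
def AtomEqs (E : EProb) : Prop := ∀ e ∈ E, ∃ a b : Atom, e = (NTerm.atom a, NTerm.atom b)

/-- One step of the equivariance algorithm 𝔈 (with fixed freshness context `Δ`) on
states `(E; A; π)`.  The first-phase rules require `π = Id`; the second-phase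
rules require that only equations between atoms are left. -/
inductive EStep (Δ : FCtx) :
    EProb × Finset Atom × NPerm → EProb × Finset Atom × NPerm → Prop
  | dec {f : Fn} {ts ss : List NTerm} {E : EProb} {A : Finset Atom} :
      ts.length = ss.length →
      EStep Δ ((.app f ts, .app f ss) ::ₘ E, A, []) (↑(List.zip ts ss) + E, A, [])
  | alp {a b : Atom} {t s : NTerm} {E : EProb} {A : Finset Atom} (c : Atom) :
      c ∉ A → c ∉ eqsAtoms ((.abs a t, .abs b s) ::ₘ E) → c ∉ ctxAtoms Δ →
      EStep Δ ((.abs a t, .abs b s) ::ₘ E, A, [])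
        ((permTerm [(c, a)] t, permTerm [(c, b)] s) ::ₘ E, A, [])
  | sus {π₁ π₂ : NPerm} {X : Var} {E : EProb} {A : Finset Atom} :
      EStep Δ ((.susp π₁ X, .susp π₂ X) ::ₘ E, A, [])
        (↑((A.filter (fun a => (a, X) ∉ Δ)).toList.map
            (fun a => (NTerm.atom (permAtom π₁ a), NTerm.atom (permAtom π₂ a)))) + E,
         A, [])
  | rem {a b : Atom} {E : EProb} {A : Finset Atom} {π : NPerm} :
      AtomEqs ((.atom a, .atom b) ::ₘ E) → permAtom π a = b →
      EStep Δ ((.atom a, .atom b) ::ₘ E, A, π) (E, A.erase b, π)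
  | sol {a b : Atom} {E : EProb} {A : Finset Atom} {π : NPerm} :
      AtomEqs ((.atom a, .atom b) ::ₘ E) →
      permAtom π a ∈ A → b ∈ A → permAtom π a ≠ b →
      EStep Δ ((.atom a, .atom b) ::ₘ E, A, π) (E, A.erase b, (permAtom π a, b) :: π)

/-! ### Permutations of atoms -/

theorem swapAtom_swapAtom (a b c : Atom) : swapAtom a b (swapAtom a b c) = c := by
  unfold swapAtom; split_ifs <;> simp_all

theorem permAtom_append (π ρ : NPerm) (c : Atom) :
    permAtom (π ++ ρ) c = permAtom π (permAtom ρ c) := by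
  induction π with
  | nil => rfl
  | cons p π ih => obtain ⟨a, b⟩ := p; simp [permAtom, ih]

theorem permAtom_permInv_left (π : NPerm) (c : Atom) :
    permAtom (permInv π) (permAtom π c) = c := by
  induction π with
  | nil => rfl
  | cons p π ih =>
    obtain ⟨a, b⟩ := p
    simp only [permInv, List.reverse_cons, permAtom_append] at ih ⊢
    simp [permAtom, swapAtom_swapAtom, ih]

theorem permInv_permInv (π : NPerm) : permInv (permInv π) = π := List.reverse_reverse π

theorem permAtom_permInv_right (π : NPerm) (c : Atom) :
    permAtom π (permAtom (permInv π) c) = c := by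
  have := permAtom_permInv_left (permInv π) c
  rwa [permInv_permInv] at this

theorem permAtom_injective (π : NPerm) : Function.Injective (permAtom π) :=
  Function.LeftInverse.injective (permAtom_permInv_left π)

theorem permInv_apply_eq_iff (π : NPerm) (a b : Atom) :
    permAtom (permInv π) a = b ↔ a = permAtom π b := by
  constructor
  · rintro rfl; rw [permAtom_permInv_right]
  · rintro rfl; rw [permAtom_permInv_left]

theorem permAtom_of_notMem (π : NPerm) (c : Atom) (h : c ∉ permAtoms π) :
    permAtom π c = c := by
  induction π with
  | nil => rfl
  | cons p π ih =>
    obtain ⟨a, b⟩ := p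
    simp only [permAtoms, Finset.mem_insert, not_or] at h
    simp [permAtom, ih h.2.2, swapAtom, h.1, h.2.1]

theorem permAtom_mem {π : NPerm} {A : Finset Atom} (h : permBased π A) {c : Atom}
    (hc : c ∈ A) : permAtom π c ∈ A := by
  induction π with
  | nil => exact hc
  | cons p π ih =>
    obtain ⟨a, b⟩ := p
    simp only [permBased, permAtoms, Finset.insert_subset_iff] at h ih
    have := ih h.2.2
    simp only [permAtom, swapAtom]
    split_ifs
    · exact h.2.1
    · exact h.1
    · exact this

theorem permAtoms_append (π ρ : NPerm) :
    permAtoms (π ++ ρ) = permAtoms π ∪ permAtoms ρ := by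
  induction π with
  | nil => simp [permAtoms]
  | cons p π ih => obtain ⟨a, b⟩ := p; simp [permAtoms, ih]

theorem permAtoms_permInv (π : NPerm) : permAtoms (permInv π) = permAtoms π := by
  induction π with
  | nil => rfl
  | cons p π ih =>
    obtain ⟨a, b⟩ := p
    simp only [permInv, List.reverse_cons, permAtoms_append] at ih ⊢
    rw [ih]; ext; simp [permAtoms]

theorem permBased_append {π ρ : NPerm} {A : Finset Atom} :
    permBased (π ++ ρ) A ↔ permBased π A ∧ permBased ρ A := by
  simp [permBased, permAtoms_append, Finset.union_subset_iff]

/-- A partial injection of a finite set of atoms into itself extends to a permutation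
based on that set. -/
theorem exists_permBased_eqOn (B D : Finset Atom) (f : Atom → Atom)
    (hf : Function.Injective f) (hD : D ⊆ B) (hfD : ∀ d ∈ D, f d ∈ B) :
    ∃ π : NPerm, permBased π B ∧ ∀ d ∈ D, permAtom π d = f d := by
  induction D using Finset.induction_on with
  | empty => exact ⟨[], by simp [permBased, permAtoms], by simp⟩
  | insert d D hd ih =>
    rw [Finset.insert_subset_iff] at hD
    obtain ⟨π, hπ, hπD⟩ := ih hD.2 (fun x hx => hfD x (Finset.mem_insert_of_mem hx))
    refine ⟨(permAtom π d, f d) :: π, ?_, ?_⟩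
    · simp only [permBased, permAtoms, Finset.insert_subset_iff]
      exact ⟨permAtom_mem hπ hD.1, hfD d (Finset.mem_insert_self _ _), hπ⟩
    · intro x hx
      rcases Finset.mem_insert.1 hx with rfl | hx
      · simp [permAtom, swapAtom]
      · have hxd : x ≠ d := fun h => hd (h ▸ hx)
        have h1 : permAtom π x ≠ permAtom π d := fun h => hxd (permAtom_injective π h)
        have h2 : permAtom π x ≠ f d := by rw [hπD x hx]; exact fun h => hxd (hf h)
        simp only [permAtom, swapAtom, if_neg h1, if_neg h2]
        exact hπD x hx

/-! ### Structural lemmas on terms -/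

theorem NTerm.induction {p : NTerm → Prop} (app : ∀ f ts, (∀ t ∈ ts, p t) → p (.app f ts))
    (atom : ∀ a, p (.atom a)) (abs : ∀ a t, p t → p (.abs a t))
    (susp : ∀ π X, p (.susp π X)) : ∀ t, p t
  | .app f ts => app f ts (fun t _ => NTerm.induction app atom abs susp t)
  | .atom a => atom a
  | .abs a t => abs a t (NTerm.induction app atom abs susp t)
  | .susp π X => susp π X

theorem permTerm_app (π : NPerm) (f : Fn) (ts : List NTerm) :
    permTerm π (.app f ts) = .app f (ts.map (permTerm π)) := by
  simp [permTerm]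

theorem permTerm_atom (π : NPerm) (a : Atom) :
    permTerm π (.atom a) = .atom (permAtom π a) := by
  simp [permTerm]

theorem permTerm_abs (π : NPerm) (a : Atom) (t : NTerm) :
    permTerm π (.abs a t) = .abs (permAtom π a) (permTerm π t) := by
  simp [permTerm]

theorem permTerm_susp (π ρ : NPerm) (X : Var) :
    permTerm π (.susp ρ X) = .susp (π ++ ρ) X := by
  simp [permTerm]

theorem substTerm_app (σ : NSubst) (f : Fn) (ts : List NTerm) :
    substTerm σ (.app f ts) = .app f (ts.map (substTerm σ)) := by
  simp [substTerm]

theorem substTerm_atom (σ : NSubst) (a : Atom) : substTerm σ (.atom a) = .atom a := by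
  simp [substTerm]

theorem substTerm_abs (σ : NSubst) (a : Atom) (t : NTerm) :
    substTerm σ (.abs a t) = .abs a (substTerm σ t) := by
  simp [substTerm]

theorem substTerm_susp (σ : NSubst) (π : NPerm) (X : Var) :
    substTerm σ (.susp π X) = permTerm π (σ X) := by
  simp [substTerm]

theorem permTerm_append (π ρ : NPerm) (t : NTerm) :
    permTerm (π ++ ρ) t = permTerm π (permTerm ρ t) := by
  induction t using NTerm.induction with
  | app f ts ih =>
    simp only [permTerm_app, List.map_map, NTerm.app.injEq, true_and]
    exact List.map_congr_left ih
  | atom a => simp [permTerm_atom, permAtom_append]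
  | abs a t ih => simp [permTerm_abs, permAtom_append, ih]
  | susp π X => simp [permTerm_susp]

theorem permTerm_nil (t : NTerm) : permTerm [] t = t := by
  induction t using NTerm.induction with
  | app f ts ih =>
    simp only [permTerm_app, NTerm.app.injEq, true_and]
    exact (List.map_congr_left ih).trans (List.map_id _)
  | atom a => simp [permTerm_atom, permAtom]
  | abs a t ih => simp [permTerm_abs, permAtom, ih]
  | susp π X => simp [permTerm_susp]

theorem substTerm_permTerm (σ : NSubst) (π : NPerm) (t : NTerm) :
    substTerm σ (permTerm π t) = permTerm π (substTerm σ t) := by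
  induction t using NTerm.induction with
  | app f ts ih =>
    simp only [permTerm_app, substTerm_app, List.map_map, NTerm.app.injEq, true_and]
    exact List.map_congr_left ih
  | atom a => simp [permTerm_atom, substTerm_atom]
  | abs a t ih => simp [permTerm_abs, substTerm_abs, ih]
  | susp π X => simp [permTerm_susp, substTerm_susp, permTerm_append]

theorem substTerm_substTerm (σ θ : NSubst) (t : NTerm) :
    substTerm θ (substTerm σ t) = substTerm (substComp σ θ) t := by
  induction t using NTerm.induction with
  | app f ts ih =>
    simp only [substTerm_app, List.map_map, NTerm.app.injEq, true_and]
    exact List.map_congr_left ih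
  | atom a => simp [substTerm_atom]
  | abs a t ih => simp [substTerm_abs, ih]
  | susp π X => simp [substTerm_susp, substTerm_permTerm, substComp]

theorem substTerm_idSubst (t : NTerm) : substTerm idSubst t = t := by
  induction t using NTerm.induction with
  | app f ts ih =>
    simp only [substTerm_app, NTerm.app.injEq, true_and]
    exact (List.map_congr_left ih).trans (List.map_id _)
  | atom a => simp [substTerm_atom]
  | abs a t ih => simp [substTerm_abs, ih]
  | susp π X => simp [substTerm_susp, idSubst, permTerm_susp]

theorem mem_foldr_union {α : Type*} [DecidableEq α] (l : List (Finset α)) (x : α) :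
    x ∈ l.foldr (· ∪ ·) ∅ ↔ ∃ s ∈ l, x ∈ s := by
  induction l with
  | nil => simp
  | cons s l ih => simp [ih]

theorem mem_termAtoms_app {f : Fn} {ts : List NTerm} {x : Atom} :
    x ∈ termAtoms (.app f ts) ↔ ∃ t ∈ ts, x ∈ termAtoms t := by
  simp [termAtoms, mem_foldr_union]

theorem mem_termVars_app {f : Fn} {ts : List NTerm} {x : Var} :
    x ∈ termVars (.app f ts) ↔ ∃ t ∈ ts, x ∈ termVars t := by
  simp [termVars, mem_foldr_union]

theorem mem_FAnoSusp_app {f : Fn} {ts : List NTerm} {x : Atom} :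
    x ∈ FAnoSusp (.app f ts) ↔ ∃ t ∈ ts, x ∈ FAnoSusp t := by
  simp [FAnoSusp, mem_foldr_union]

theorem termBased_app {f : Fn} {ts : List NTerm} {A : Finset Atom} :
    termBased (.app f ts) A ↔ ∀ t ∈ ts, termBased t A := by
  simp only [termBased, Finset.subset_iff, mem_termAtoms_app]
  grind

theorem termBased_abs {a : Atom} {t : NTerm} {A : Finset Atom} :
    termBased (.abs a t) A ↔ a ∈ A ∧ termBased t A := by
  simp [termBased, termAtoms, Finset.insert_subset_iff]

theorem termBased_susp {π : NPerm} {X : Var} {A : Finset Atom} :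
    termBased (.susp π X) A ↔ permBased π A := by
  simp [termBased, termAtoms, permBased]

theorem termBased_permTerm {π : NPerm} {A : Finset Atom} (hπ : permBased π A) {t : NTerm}
    (ht : termBased t A) : termBased (permTerm π t) A := by
  induction t using NTerm.induction with
  | app f ts ih =>
    rw [termBased_app] at ht
    rw [permTerm_app, termBased_app]
    intro t h
    obtain ⟨u, hu, rfl⟩ := List.mem_map.1 h
    exact ih u hu (ht u hu)
  | atom a =>
    simp only [termBased, termAtoms, permTerm_atom, Finset.singleton_subset_iff] at ht ⊢
    exact permAtom_mem hπ ht
  | abs a t ih =>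
    rw [termBased_abs] at ht
    rw [permTerm_abs, termBased_abs]
    exact ⟨permAtom_mem hπ ht.1, ih ht.2⟩
  | susp ρ X =>
    rw [termBased_susp] at ht
    rw [permTerm_susp, termBased_susp, permBased_append]
    exact ⟨hπ, ht⟩

theorem termVars_permTerm (π : NPerm) (t : NTerm) : termVars (permTerm π t) = termVars t := by
  induction t using NTerm.induction with
  | app f ts ih =>
    ext x
    simp only [permTerm_app, mem_termVars_app, List.mem_map, exists_exists_and_eq_and]
    exact exists_congr fun t => and_congr_right fun ht => by rw [ih t ht]
  | atom a => simp [permTerm_atom, termVars]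
  | abs a t ih => simp [permTerm_abs, termVars, ih]
  | susp ρ X => simp [permTerm_susp, termVars]

theorem exists_mem_termVars_of_substTerm {τ : NSubst} {t : NTerm} {Z : Var}
    (h : Z ∈ termVars (substTerm τ t)) : ∃ Y ∈ termVars t, Z ∈ termVars (τ Y) := by
  induction t using NTerm.induction with
  | app f ts ih =>
    simp only [substTerm_app, mem_termVars_app, List.mem_map, exists_exists_and_eq_and] at h ⊢
    obtain ⟨t, ht, hZ⟩ := h
    obtain ⟨Y, hY, hZ⟩ := ih t ht hZ
    exact ⟨Y, ⟨t, ht, hY⟩, hZ⟩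
  | atom a => simp [substTerm_atom, termVars] at h
  | abs a t ih =>
    simp only [substTerm_abs, termVars] at h ⊢
    exact ih h
  | susp ρ X =>
    simp only [substTerm_susp, termVars_permTerm] at h
    exact ⟨X, by simp [termVars], h⟩

/-- Numeric code of a term. -/
def NTerm.code : NTerm → ℕ
  | .app f ts => Nat.pair 0 (Nat.pair f (Encodable.encode (ts.attach.map (fun x => x.1.code))))
  | .atom a => Nat.pair 1 a
  | .abs a t => Nat.pair 2 (Nat.pair a t.code)
  | .susp π X => Nat.pair 3 (Nat.pair (Encodable.encode π) X)
decreasing_by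
  all_goals (simp_wf; try omega)
  all_goals (have := List.sizeOf_lt_of_mem x.2; omega)

theorem NTerm.code_injective : Function.Injective NTerm.code := by
  intro t
  induction t using NTerm.induction with
  | app f ts ih =>
    intro s h
    cases s <;> simp [NTerm.code, Nat.pair_eq_pair] at h
    obtain ⟨rfl, h⟩ := h
    congr 1
    rename_i ss
    induction ts generalizing ss with
    | nil => cases ss <;> simp_all
    | cons t ts iht =>
      cases ss with
      | nil => simp at h
      | cons s ss =>
        simp only [List.map_cons, List.cons.injEq] at h
        rw [ih t (by simp) h.1, iht (fun u hu => ih u (by simp [hu])) ss h.2]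
  | atom a => intro s h; cases s <;> simp_all [NTerm.code, Nat.pair_eq_pair]
  | abs a t ih =>
    intro s h
    cases s <;> simp [NTerm.code, Nat.pair_eq_pair] at h
    rw [h.1, ih h.2]
  | susp ρ X => intro s h; cases s <;> simp_all [NTerm.code, Nat.pair_eq_pair]

/-! ### Freshness -/

section Fresh

variable {Δ : Set (Atom × Var)}

theorem nFresh_atom {a b : Atom} : NFresh Δ a (.atom b) ↔ a ≠ b :=
  ⟨fun h => by cases h; assumption, .atom⟩

theorem nFresh_susp {a : Atom} {π : NPerm} {X : Var} :
    NFresh Δ a (.susp π X) ↔ (permAtom (permInv π) a, X) ∈ Δ :=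
  ⟨fun h => by cases h; assumption, .susp⟩

theorem nFresh_app {a : Atom} {f : Fn} {ts : List NTerm} :
    NFresh Δ a (.app f ts) ↔ ∀ t ∈ ts, NFresh Δ a t :=
  ⟨fun h => by cases h; assumption, .app⟩

theorem nFresh_abs {a b : Atom} {t : NTerm} :
    NFresh Δ a (.abs b t) ↔ a = b ∨ NFresh Δ a t := by
  constructor
  · intro h
    cases h with
    | abs1 => exact .inl rfl
    | abs2 _ h => exact .inr h
  · intro h
    by_cases hab : a = b
    · subst hab; exact .abs1
    · exact .abs2 hab (h.resolve_left hab)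

theorem nFresh_permTerm {π : NPerm} {a : Atom} {t : NTerm} :
    NFresh Δ a (permTerm π t) ↔ NFresh Δ (permAtom (permInv π) a) t := by
  induction t using NTerm.induction with
  | app f ts ih =>
    simp only [permTerm_app, nFresh_app, List.mem_map, forall_exists_index, and_imp,
      forall_apply_eq_imp_iff₂]
    exact forall₂_congr ih
  | atom b => rw [permTerm_atom, nFresh_atom, nFresh_atom, Ne, Ne, permInv_apply_eq_iff]
  | abs b t ih => rw [permTerm_abs, nFresh_abs, nFresh_abs, ih, permInv_apply_eq_iff]
  | susp ρ X =>
    rw [permTerm_susp, nFresh_susp, nFresh_susp]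
    simp [permInv, permAtom_append]

theorem NFresh.substTerm {Δ' : Set (Atom × Var)} {θ : NSubst}
    (hθ : ∀ a X, (a, X) ∈ Δ → NFresh Δ' a (θ X)) {a : Atom} {t : NTerm} (h : NFresh Δ a t) :
    NFresh Δ' a (substTerm θ t) := by
  induction t using NTerm.induction with
  | app f ts ih =>
    simp only [substTerm_app, nFresh_app, List.mem_map, forall_exists_index, and_imp,
      forall_apply_eq_imp_iff₂] at h ⊢
    exact fun t ht => ih t ht (h t ht)
  | atom b => rw [substTerm_atom, nFresh_atom]; exact nFresh_atom.1 h
  | abs b t ih =>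
    rw [substTerm_abs, nFresh_abs]
    exact (nFresh_abs.1 h).imp_right ih
  | susp ρ X =>
    rw [substTerm_susp, nFresh_permTerm]
    exact hθ _ _ (nFresh_susp.1 h)

theorem NFresh.notMem_FAnoSusp {a : Atom} {t : NTerm} (h : NFresh Δ a t) :
    a ∉ FAnoSusp t := by
  induction t using NTerm.induction with
  | app f ts ih =>
    rw [mem_FAnoSusp_app]
    rintro ⟨t, ht, ha⟩
    exact ih t ht (nFresh_app.1 h t ht) ha
  | atom b => simpa [FAnoSusp] using nFresh_atom.1 h
  | abs b t ih =>
    simp only [FAnoSusp, Finset.mem_sdiff, Finset.mem_singleton, not_and, not_not]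
    intro ha
    exact (nFresh_abs.1 h).resolve_right (fun h' => ih h' ha)
  | susp ρ X => simp [FAnoSusp]

end Fresh

/-! ### Nameless denotations of nominal terms -/

/-- Nameless terms: a suspension records where each unconstrained atom is sent. -/
inductive DTerm where
  | app : Fn → List DTerm → DTerm
  | atom : ℕ → DTerm
  | abs : DTerm → DTerm
  | susp : Var → (Atom → Option ℕ) → DTerm

/-- Extension of an environment when passing below a binder. -/
def extEnv (e : Atom → ℕ) (a : Atom) : Atom → ℕ := fun x => if x = a then 0 else e x + 1

open Classical in
/-- The nameless denotation of a term in an environment. -/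
noncomputable def den (Δ : Set (Atom × Var)) (e : Atom → ℕ) : NTerm → DTerm
  | .app f ts => .app f (ts.attach.map (fun x => den Δ e x.1))
  | .atom a => .atom (e a)
  | .abs a t => .abs (den Δ (extEnv e a) t)
  | .susp π X => .susp X (fun x => if (x, X) ∈ Δ then none else some (e (permAtom π x)))
decreasing_by
  all_goals (simp_wf; try omega)
  all_goals (have := List.sizeOf_lt_of_mem x.2; omega)

section Den

variable {Δ : Set (Atom × Var)}

theorem den_app (e : Atom → ℕ) (f : Fn) (ts : List NTerm) :
    den Δ e (.app f ts) = .app f (ts.map (den Δ e)) := by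
  simp [den]

theorem den_atom (e : Atom → ℕ) (a : Atom) : den Δ e (.atom a) = .atom (e a) := by
  simp [den]

theorem den_abs (e : Atom → ℕ) (a : Atom) (t : NTerm) :
    den Δ e (.abs a t) = .abs (den Δ (extEnv e a) t) := by
  simp [den]

theorem den_susp_eq_iff {e e' : Atom → ℕ} {π π' : NPerm} {X X' : Var} :
    den Δ e (.susp π X) = den Δ e' (.susp π' X') ↔
      X = X' ∧ ∀ x, (x, X) ∉ Δ → e (permAtom π x) = e' (permAtom π' x) := by
  simp only [den, DTerm.susp.injEq]
  constructor
  · rintro ⟨rfl, h⟩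
    refine ⟨rfl, fun x hx => ?_⟩
    have := congrFun h x
    simpa [hx] using this
  · rintro ⟨rfl, h⟩
    refine ⟨rfl, funext fun x => ?_⟩
    by_cases hx : (x, X) ∈ Δ <;> simp [hx, h x]

theorem extEnv_injective {e : Atom → ℕ} (he : Function.Injective e) (a : Atom) :
    Function.Injective (extEnv e a) := by
  intro x y h
  simp only [extEnv] at h
  split_ifs at h with h1 h2 h2
  · rw [h1, h2]
  · exact he (by omega)

theorem extEnv_comp (e : Atom → ℕ) (π : NPerm) (a : Atom) :
    extEnv (e ∘ permAtom π) a = extEnv e (permAtom π a) ∘ permAtom π := by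
  funext x
  simp [extEnv, (permAtom_injective π).eq_iff]

theorem den_permTerm (e : Atom → ℕ) (π : NPerm) (t : NTerm) :
    den Δ e (permTerm π t) = den Δ (e ∘ permAtom π) t := by
  induction t using NTerm.induction generalizing e with
  | app f ts ih =>
    simp only [permTerm_app, den_app, List.map_map, DTerm.app.injEq, true_and]
    exact List.map_congr_left (fun t ht => ih t ht e)
  | atom a => simp [permTerm_atom, den_atom]
  | abs a t ih => rw [permTerm_abs, den_abs, den_abs, ih, extEnv_comp]
  | susp ρ X => rw [permTerm_susp, den_susp_eq_iff]; simp [permAtom_append]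

/-- Two environments give the same denotation iff they agree on the non-fresh atoms. -/
theorem den_eq_den_iff {e e' : Atom → ℕ} {t : NTerm} :
    den Δ e t = den Δ e' t ↔ ∀ x, ¬ NFresh Δ x t → e x = e' x := by
  induction t using NTerm.induction generalizing e e' with
  | app f ts ih =>
    simp only [den_app, DTerm.app.injEq, true_and, List.map_inj_left, nFresh_app, not_forall]
    constructor
    · rintro h x ⟨t, ht, hx⟩
      exact (ih t ht).1 (h t ht) x hx
    · exact fun h t ht => (ih t ht).2 (fun x hx => h x ⟨t, ht, hx⟩)
  | atom a => simp [den_atom, nFresh_atom]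
  | abs a t ih =>
    simp only [den_abs, DTerm.abs.injEq, ih, nFresh_abs, not_or, and_imp]
    refine forall_congr' fun x => ?_
    by_cases hx : x = a <;> simp [extEnv, hx]
  | susp ρ X =>
    simp only [den_susp_eq_iff, true_and, nFresh_susp]
    constructor
    · intro h x hx
      simpa [permAtom_permInv_right] using h _ hx
    · intro h x hx
      exact h _ (by rwa [permAtom_permInv_left])

theorem exists_not_nFresh_of_den_eq {e e' : Atom → ℕ} {t t' : NTerm}
    (h : den Δ e t = den Δ e' t') {x : Atom} (hx : ¬ NFresh Δ x t) :
    ∃ y, ¬ NFresh Δ y t' ∧ e x = e' y := by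
  induction t using NTerm.induction generalizing e e' t' x with
  | app f ts ih =>
    cases t' <;> simp [den_app, den] at h
    obtain ⟨rfl, h⟩ := h
    rename_i ts'
    simp only [nFresh_app, not_forall] at hx ⊢
    obtain ⟨t, ht, hx⟩ := hx
    have : den Δ e t ∈ ts'.map (den Δ e') := h ▸ List.mem_map_of_mem ht
    obtain ⟨t', ht', h'⟩ := List.mem_map.1 this
    obtain ⟨y, hy, hxy⟩ := ih t ht h'.symm hx
    exact ⟨y, ⟨t', ht', hy⟩, hxy⟩
  | atom a =>
    cases t' <;> simp [den] at h
    simp only [nFresh_atom, not_not] at hx ⊢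
    exact ⟨_, rfl, hx ▸ h⟩
  | abs a t ih =>
    cases t' <;> simp [den] at h
    simp only [nFresh_abs, not_or] at hx ⊢
    obtain ⟨y, hy, hxy⟩ := ih h hx.2
    simp only [extEnv, if_neg hx.1] at hxy
    split_ifs at hxy with hya
    exact ⟨y, ⟨hya, hy⟩, by omega⟩
  | susp ρ X =>
    cases t' with
    | susp ρ' X' =>
      obtain ⟨rfl, hd⟩ := den_susp_eq_iff.1 h
      rw [nFresh_susp] at hx
      refine ⟨permAtom ρ' (permAtom (permInv ρ) x), ?_, ?_⟩
      · rwa [nFresh_susp, permAtom_permInv_left]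
      · rw [← hd _ hx, permAtom_permInv_right]
    | _ => simp [den] at h

/-- An atom that occurs in neither of two terms is interpreted in the same way as soon as
it is not fresh. -/
theorem env_eq_of_den_eq {e e' : Atom → ℕ} {t t' : NTerm}
    (h : den Δ e t = den Δ e' t') {x : Atom} (hx : ¬ NFresh Δ x t)
    (ht : x ∉ termAtoms t) (ht' : x ∉ termAtoms t') : e x = e' x := by
  induction t using NTerm.induction generalizing e e' t' with
  | app f ts ih =>
    cases t' <;> simp [den_app, den] at h
    obtain ⟨rfl, h⟩ := h
    rename_i ts'
    simp only [nFresh_app, not_forall] at hx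
    obtain ⟨t, htm, hx⟩ := hx
    have : den Δ e t ∈ ts'.map (den Δ e') := h ▸ List.mem_map_of_mem htm
    obtain ⟨t', htm', h'⟩ := List.mem_map.1 this
    exact ih t htm h'.symm hx (fun hh => ht (mem_termAtoms_app.2 ⟨t, htm, hh⟩))
      (fun hh => ht' (mem_termAtoms_app.2 ⟨t', htm', hh⟩))
  | atom a =>
    simp only [nFresh_atom, not_not] at hx
    simp [termAtoms, hx] at ht
  | abs a t ih =>
    cases t' <;> simp [den] at h
    simp only [nFresh_abs, not_or] at hx
    simp only [termAtoms, Finset.mem_insert, not_or] at ht ht'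
    have := ih h hx.2 ht.2 ht'.2
    simpa [extEnv, ht.1, ht'.1] using this
  | susp ρ X =>
    cases t' with
    | susp ρ' X' =>
      obtain ⟨rfl, hd⟩ := den_susp_eq_iff.1 h
      simp only [termAtoms] at ht ht'
      rw [nFresh_susp, permAtom_of_notMem _ _ (by rwa [permAtoms_permInv])] at hx
      have := hd x hx
      rwa [permAtom_of_notMem _ _ ht, permAtom_of_notMem _ _ ht'] at this
    | _ => simp [den] at h

theorem extEnv_swap (e : Atom → ℕ) (a b x : Atom) (hx : x ≠ a ∨ a = b) :
    (extEnv e a ∘ permAtom [(a, b)]) x = extEnv e b x := by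
  simp only [Function.comp, permAtom, swapAtom, extEnv]
  grind

theorem NAlpha.den_eq {t s : NTerm} (h : NAlpha Δ t s) (e : Atom → ℕ) :
    den Δ e t = den Δ e s := by
  induction h generalizing e with
  | atom a => rfl
  | abs1 _ ih => rw [den_abs, den_abs, ih]
  | @abs2 a b t t' hab _ hf ih =>
    rw [den_abs, den_abs, ih, den_permTerm]
    congr 1
    exact den_eq_den_iff.2 fun x hx => extEnv_swap _ _ _ _ (.inl fun h => hx (h ▸ hf))
  | susp h =>
    rw [den_susp_eq_iff]
    refine ⟨rfl, fun x hx => ?_⟩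
    by_contra hne
    exact hx (h x fun h' => hne (by rw [h']))
  | @app f ts ss hl _ ih =>
    rw [den_app, den_app]
    congr 1
    refine List.ext_getElem (by simpa using hl) fun i h1 h2 => ?_
    simp only [List.length_map] at h1 h2
    simp only [List.getElem_map]
    refine ih (ts[i], ss[i]) ?_ e
    rw [List.mem_iff_getElem]
    exact ⟨i, by simp [h1, h2], by simp⟩

theorem nAlpha_of_den_eq {e : Atom → ℕ} (he : Function.Injective e) {t s : NTerm}
    (h : den Δ e t = den Δ e s) : NAlpha Δ t s := by
  induction t using NTerm.induction generalizing e s with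
  | app f ts ih =>
    cases s <;> simp [den_app, den] at h
    obtain ⟨rfl, h⟩ := h
    rename_i ss
    have hl : ts.length = ss.length := by simpa using congrArg List.length h
    refine .app hl fun p hp => ?_
    obtain ⟨i, hi, rfl⟩ := List.mem_iff_getElem.1 hp
    simp only [List.length_zip, lt_inf_iff] at hi
    simp only [List.getElem_zip]
    refine ih _ (List.getElem_mem _) he ?_
    have := List.getElem_of_eq h (i := i) (by simpa using hi.1)
    simpa using this
  | atom a =>
    cases s <;> simp [den] at h
    rw [he h]; exact .atom _
  | abs a t ih =>
    cases s <;> simp [den] at h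
    rename_i b t'
    by_cases hab : a = b
    · subst hab
      exact .abs1 (ih (extEnv_injective he a) h)
    · have hf : NFresh Δ a t' := by
        by_contra hf
        obtain ⟨y, -, hy⟩ := exists_not_nFresh_of_den_eq h.symm hf
        simp only [extEnv, if_neg hab] at hy
        split_ifs at hy with hya
        exact hya (he (by omega)).symm
      refine .abs2 hab (ih (extEnv_injective he a) ?_) hf
      rw [h, den_permTerm]
      exact (den_eq_den_iff.2 fun x hx =>
        extEnv_swap _ _ _ _ (.inl fun h => hx (h ▸ hf))).symm
  | susp ρ X =>
    cases s with
    | susp ρ' X' =>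
      obtain ⟨rfl, hd⟩ := den_susp_eq_iff.1 h
      refine .susp fun a ha => ?_
      by_contra hn
      exact ha (he (hd a hn))
    | _ => simp [den] at h

theorem nAlpha_iff {t s : NTerm} : NAlpha Δ t s ↔ ∀ e, den Δ e t = den Δ e s :=
  ⟨NAlpha.den_eq, fun h => nAlpha_of_den_eq Function.injective_id (h id)⟩

theorem NAlpha.refl (t : NTerm) : NAlpha Δ t t := nAlpha_iff.2 fun _ => rfl

theorem NAlpha.symm {t s : NTerm} (h : NAlpha Δ t s) : NAlpha Δ s t :=
  nAlpha_iff.2 fun e => (h.den_eq e).symm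

theorem NAlpha.trans {t s u : NTerm} (h : NAlpha Δ t s) (h' : NAlpha Δ s u) : NAlpha Δ t u :=
  nAlpha_iff.2 fun e => (h.den_eq e).trans (h'.den_eq e)

theorem NAlpha.permTerm {t s : NTerm} (π : NPerm) (h : NAlpha Δ t s) :
    NAlpha Δ (permTerm π t) (permTerm π s) :=
  nAlpha_iff.2 fun e => by rw [den_permTerm, den_permTerm, h.den_eq]

theorem nAlpha_permInv_permTerm (π : NPerm) (t : NTerm) :
    NAlpha Δ (_root_.permTerm (permInv π) (_root_.permTerm π t)) t :=
  nAlpha_iff.2 fun e => by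
    rw [den_permTerm, den_permTerm]
    congr 1
    funext x
    simp [permAtom_permInv_left]

theorem NAlpha.nFresh {t s : NTerm} (h : NAlpha Δ t s) {a : Atom} (ha : NFresh Δ a t) :
    NFresh Δ a s := by
  by_contra hn
  obtain ⟨y, hy, hay⟩ := exists_not_nFresh_of_den_eq (h.den_eq id).symm hn
  simp only [id] at hay
  exact hy (hay ▸ ha)

theorem nAlpha_abs_iff {a b : Atom} {t s : NTerm} :
    NAlpha Δ (.abs a t) (.abs b s) ↔
      NFresh Δ a (.abs b s) ∧ NAlpha Δ t (permTerm [(a, b)] s) := by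
  constructor
  · intro h
    have hf := h.nFresh .abs1
    refine ⟨hf, nAlpha_of_den_eq (extEnv_injective Function.injective_id a) ?_⟩
    have := h.den_eq id
    rw [den_abs, den_abs, DTerm.abs.injEq] at this
    rw [this, den_permTerm]
    refine (den_eq_den_iff.2 fun x hx => extEnv_swap _ _ _ _ ?_).symm
    rcases nFresh_abs.1 hf with h | h
    · exact .inr h
    · exact .inl fun h' => hx (h' ▸ h)
  · rintro ⟨hf, h⟩
    rw [nAlpha_iff]
    intro e
    rw [den_abs, den_abs, h.den_eq, den_permTerm]
    congr 1
    refine (den_eq_den_iff.2 fun x hx => extEnv_swap _ _ _ _ ?_)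
    rcases nFresh_abs.1 hf with h | h
    · exact .inr h
    · exact .inl fun h' => hx (h' ▸ h)

theorem nAlpha_app_iff {f g : Fn} {ts ss : List NTerm} :
    NAlpha Δ (.app f ts) (.app g ss) ↔ f = g ∧ List.Forall₂ (NAlpha Δ) ts ss := by
  rw [List.forall₂_iff_zip]
  constructor
  · intro h
    cases h with
    | app hl h => exact ⟨rfl, hl, fun hab => h _ hab⟩
  · rintro ⟨rfl, hl, h⟩
    exact .app hl fun p hp => h hp

theorem NAlpha.substTerm {Δ' : Set (Atom × Var)} {θ : NSubst}
    (hθ : ∀ a X, (a, X) ∈ Δ → NFresh Δ' a (θ X)) {t s : NTerm} (h : NAlpha Δ t s) :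
    NAlpha Δ' (substTerm θ t) (substTerm θ s) := by
  suffices H : ∀ (t s : NTerm) (e e' : Atom → ℕ), den Δ e t = den Δ e' s →
      den Δ' e (_root_.substTerm θ t) = den Δ' e' (_root_.substTerm θ s) from
    nAlpha_iff.2 fun e => H t s e e (h.den_eq e)
  intro t
  induction t using NTerm.induction with
  | app f ts ih =>
    intro s e e' h
    cases s <;> simp [den_app, den] at h
    obtain ⟨rfl, h⟩ := h
    rename_i ss
    have hl : ts.length = ss.length := by simpa using congrArg List.length h
    simp only [substTerm_app, den_app, List.map_map, DTerm.app.injEq, true_and]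
    refine List.ext_getElem (by simpa using hl) fun i h1 h2 => ?_
    simp only [List.length_map] at h1 h2
    have := List.getElem_of_eq h (i := i) (by simpa using h1)
    simp only [List.getElem_map] at this
    simpa using ih _ (List.getElem_mem h1) _ e e' this
  | atom a =>
    intro s e e' h
    cases s <;> simp [den] at h
    simp [substTerm_atom, den_atom, h]
  | abs a t ih =>
    intro s e e' h
    cases s <;> simp [den] at h
    rw [substTerm_abs, substTerm_abs, den_abs, den_abs, ih _ _ _ h]
  | susp ρ X =>
    intro s e e' h
    cases s with
    | susp ρ' X' =>
      obtain ⟨rfl, hd⟩ := den_susp_eq_iff.1 h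
      rw [substTerm_susp, substTerm_susp, den_permTerm, den_permTerm, den_eq_den_iff]
      exact fun x hx => hd x fun hm => hx (hθ x X hm)
    | _ => simp [den] at h

theorem nAlpha_substTerm_congr {τ τ' : NSubst} {t : NTerm}
    (h : ∀ X ∈ termVars t, NAlpha Δ (τ X) (τ' X)) :
    NAlpha Δ (substTerm τ t) (substTerm τ' t) := by
  rw [nAlpha_iff]
  induction t using NTerm.induction with
  | app f ts ih =>
    intro e
    simp only [substTerm_app, den_app, List.map_map, DTerm.app.injEq, true_and]
    exact List.map_congr_left fun t ht =>
      ih t ht (fun X hX => h X (mem_termVars_app.2 ⟨t, ht, hX⟩)) e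
  | atom a => simp [substTerm_atom]
  | abs a t ih =>
    intro e
    rw [substTerm_abs, substTerm_abs, den_abs, den_abs, ih (by simpa [termVars] using h)]
  | susp ρ X =>
    intro e
    rw [substTerm_susp, substTerm_susp]
    exact ((h X (by simp [termVars])).permTerm ρ).den_eq e

/-- Two pairs of terms related by some permutation are related by one that is based on
their atoms. -/
theorem exists_permBased_nAlpha {ρ : NPerm} {t₁ s₁ t₂ s₂ : NTerm}
    (ht : NAlpha Δ (permTerm ρ t₁) t₂) (hs : NAlpha Δ (permTerm ρ s₁) s₂) :
    ∃ π : NPerm,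
      permBased π (termAtoms t₁ ∪ termAtoms s₁ ∪ termAtoms t₂ ∪ termAtoms s₂) ∧
      NAlpha Δ (permTerm π t₁) t₂ ∧ NAlpha Δ (permTerm π s₁) s₂ := by
  classical
  set B := termAtoms t₁ ∪ termAtoms s₁ ∪ termAtoms t₂ ∪ termAtoms s₂ with hB
  have key : ∀ u₁ u₂ : NTerm, termAtoms u₁ ⊆ B → termAtoms u₂ ⊆ B →
      NAlpha Δ (permTerm ρ u₁) u₂ → ∀ x, ¬ NFresh Δ x u₁ →
      (x ∉ B → permAtom ρ x = x) ∧ (x ∈ B → permAtom ρ x ∈ B) := by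
    intro u₁ u₂ h₁ h₂ h x hx
    have hd := h.den_eq id
    rw [den_permTerm] at hd
    refine ⟨fun hxB => env_eq_of_den_eq hd hx (fun h => hxB (h₁ h)) (fun h => hxB (h₂ h)),
      fun hxB => ?_⟩
    by_contra hn
    have hd' := h.den_eq (permAtom (permInv ρ))
    rw [den_permTerm] at hd'
    have hx' : ¬ NFresh Δ (permAtom ρ x) u₂ := fun hf =>
      hx (by simpa [nFresh_permTerm, permAtom_permInv_left] using h.symm.nFresh hf)
    have := env_eq_of_den_eq hd'.symm hx' (fun h => hn (h₂ h)) (fun h => hn (h₁ h))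
    simp only [Function.comp, permAtom_permInv_left] at this
    exact hn (this ▸ hxB)
  have keyt := key t₁ t₂ (by grind) (by grind) ht
  have keys := key s₁ s₂ (by grind) (by grind) hs
  obtain ⟨π, hπ, hπD⟩ := exists_permBased_eqOn B
    (B.filter fun x => ¬ NFresh Δ x t₁ ∨ ¬ NFresh Δ x s₁) (permAtom ρ) (permAtom_injective ρ)
    (Finset.filter_subset _ _) (by
      intro d hd
      obtain ⟨hdB, hd⟩ := Finset.mem_filter.1 hd
      rcases hd with hd | hd
      · exact (keyt d hd).2 hdB
      · exact (keys d hd).2 hdB)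
  have agree : ∀ x, ¬ NFresh Δ x t₁ ∨ ¬ NFresh Δ x s₁ → permAtom π x = permAtom ρ x := by
    intro x hx
    by_cases hxB : x ∈ B
    · exact hπD x (Finset.mem_filter.2 ⟨hxB, hx⟩)
    · rw [permAtom_of_notMem _ _ (fun h => hxB (hπ h))]
      rcases hx with hx | hx
      · exact ((keyt x hx).1 hxB).symm
      · exact ((keys x hx).1 hxB).symm
  refine ⟨π, hπ, NAlpha.trans ?_ ht, NAlpha.trans ?_ hs⟩ <;>
  · rw [nAlpha_iff]
    intro e
    rw [den_permTerm, den_permTerm, den_eq_den_iff]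
    intro x hx
    simp [agree x (by tauto)]

end Den

/-! ### Guides for the algorithm -/

/-- One of the rules decomposing a pair of terms applies. -/
def Splits (A : Finset Atom) (Δ : FCtx) (t s : NTerm) : Prop :=
  (∃ f ts ss, t = .app f ts ∧ s = .app f ss ∧ ts.length = ss.length) ∨
  (∃ a, t = .atom a ∧ s = .atom a) ∨
  (∃ a t' b s', t = .abs a t' ∧ s = .abs b s' ∧
    ∃ c ∈ A, NFresh (↑Δ : Set (Atom × Var)) c t ∧ NFresh (↑Δ : Set (Atom × Var)) c s)

theorem solCond_of_not_splits {A : Finset Atom} {Δ : FCtx} {t s : NTerm}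
    (h : ¬ Splits A Δ t s) : SolCond A Δ t s := by
  by_cases hh : headOf t = headOf s
  · right
    cases t <;> cases s <;> simp [headOf] at hh <;> simp [IsSusp, IsAbs]
    · exact h (.inl ⟨_, _, _, rfl, by rw [hh.1], hh.2⟩)
    · exact h (.inr (.inl ⟨_, rfl, by rw [hh]⟩))
    · intro c hc h1 h2
      exact h (.inr (.inr ⟨_, _, _, _, rfl, rfl, c, hc, h1, h2⟩))
  · exact .inl hh

theorem Splits.of_permTerm {A : Finset Atom} {Δ : FCtx} {ρ : NPerm} (hρ : permBased ρ A)
    {t s t' s' : NTerm} (ht : NAlpha (↑Δ : Set (Atom × Var)) (permTerm ρ t') t)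
    (hs : NAlpha (↑Δ : Set (Atom × Var)) (permTerm ρ s') s) (h : Splits A Δ t s) :
    Splits A Δ t' s' := by
  have hρ' : permBased (permInv ρ) A := by rwa [permBased, permAtoms_permInv]
  have fr : ∀ {u u' : NTerm} {c : Atom}, NAlpha (↑Δ : Set (Atom × Var)) (permTerm ρ u') u →
      NFresh (↑Δ : Set (Atom × Var)) c u →
      NFresh (↑Δ : Set (Atom × Var)) (permAtom (permInv ρ) c) u' :=
    fun h hc => nFresh_permTerm.1 (h.symm.nFresh hc)
  rcases h with ⟨f, ts, ss, rfl, rfl, hl⟩ | ⟨a, rfl, rfl⟩ | ⟨a, u, b, v, rfl, rfl, c, hc, h1, h2⟩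
  · cases t' with
    | app g ts' =>
      cases s' with
      | app g' ss' =>
        rw [permTerm_app, nAlpha_app_iff] at ht hs
        refine .inl ⟨g, ts', ss', rfl, by rw [ht.1, hs.1], ?_⟩
        have h1 := ht.2.length_eq
        have h2 := hs.2.length_eq
        simp only [List.length_map] at h1 h2
        omega
      | _ => simp only [permTerm_atom, permTerm_abs, permTerm_susp] at hs; cases hs
    | _ => simp only [permTerm_atom, permTerm_abs, permTerm_susp] at ht; cases ht
  · cases t' with
    | atom a' =>
      cases s' with
      | atom b' =>
        have h1 := ht.den_eq id
        have h2 := hs.den_eq id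
        simp only [permTerm_atom, den_atom, id, DTerm.atom.injEq] at h1 h2
        have := permAtom_injective ρ (h1.trans h2.symm)
        exact .inr (.inl ⟨a', rfl, by rw [this]⟩)
      | _ => simp only [permTerm_app, permTerm_abs, permTerm_susp] at hs; cases hs
    | _ => simp only [permTerm_app, permTerm_abs, permTerm_susp] at ht; cases ht
  · have h1' := fr ht h1
    have h2' := fr hs h2
    cases t' with
    | abs a' t' =>
      cases s' with
      | abs b' s' =>
        exact .inr (.inr ⟨_, _, _, _, rfl, rfl, _, permAtom_mem hρ' hc, h1', h2'⟩)
      | _ => simp only [permTerm_app, permTerm_atom, permTerm_susp] at hs; cases hs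
    | _ => simp only [permTerm_app, permTerm_atom, permTerm_susp] at ht; cases ht

/-- Terms whose binders and suspended permutations are based on `A` and whose variables
satisfy `L`. -/
inductive IsGuide (A : Finset Atom) (L : Var → Prop) : NTerm → Prop
  | app {f : Fn} {ts : List NTerm} : (∀ t ∈ ts, IsGuide A L t) → IsGuide A L (.app f ts)
  | atom {a : Atom} : IsGuide A L (.atom a)
  | abs {c : Atom} {t : NTerm} : c ∈ A → IsGuide A L t → IsGuide A L (.abs c t)
  | susp {π : NPerm} {X : Var} : permBased π A → L X → IsGuide A L (.susp π X)

theorem IsGuide.permTerm {A : Finset Atom} {L : Var → Prop} {π : NPerm} (hπ : permBased π A)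
    {t : NTerm} (h : IsGuide A L t) : IsGuide A L (permTerm π t) := by
  induction h with
  | app _ ih =>
    rw [permTerm_app]
    refine .app fun t ht => ?_
    obtain ⟨u, hu, rfl⟩ := List.mem_map.1 ht
    exact ih u hu
  | atom => rw [permTerm_atom]; exact .atom
  | abs hc _ ih => rw [permTerm_abs]; exact .abs (permAtom_mem hπ hc) ih
  | susp hρ hX => rw [permTerm_susp]; exact .susp (permBased_append.2 ⟨hπ, hρ⟩) hX

theorem isGuide_substTerm {A : Finset Atom} {L : Var → Prop} {τ : NSubst}
    (hτ : ∀ X, IsGuide A L (τ X)) {t : NTerm} (ht : termBased t A) :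
    IsGuide A L (substTerm τ t) := by
  induction t using NTerm.induction with
  | app f ts ih =>
    rw [substTerm_app]
    refine .app fun t h => ?_
    obtain ⟨u, hu, rfl⟩ := List.mem_map.1 h
    exact ih u hu (termBased_app.1 ht u hu)
  | atom a => rw [substTerm_atom]; exact .atom
  | abs a t ih =>
    rw [termBased_abs] at ht
    rw [substTerm_abs]
    exact .abs ht.1 (ih ht.2)
  | susp π X =>
    rw [substTerm_susp]
    exact (hτ X).permTerm (termBased_susp.1 ht)

/-- The freshness constraints from `A` shared by the two instances of each variable. -/
def pairCtx (A : Finset Atom) (Δ : FCtx) (φ₁ φ₂ : NSubst) : Set (Atom × Var) :=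
  {p | p.1 ∈ A ∧ NFresh (↑Δ : Set (Atom × Var)) p.1 (φ₁ p.2) ∧
    NFresh (↑Δ : Set (Atom × Var)) p.1 (φ₂ p.2)}

theorem exists_guide_of_not_splits {A : Finset Atom} {Δ : FCtx} {φ₁ φ₂ : NSubst}
    (hφ : ∀ t s, ∃ W, φ₁ W = t ∧ φ₂ W = s) {t s : NTerm} (h : ¬ Splits A Δ t s) :
    ∃ g, IsGuide A (fun W => ¬ Splits A Δ (φ₁ W) (φ₂ W)) g ∧
      NAlpha (↑Δ : Set (Atom × Var)) (substTerm φ₁ g) t ∧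
      NAlpha (↑Δ : Set (Atom × Var)) (substTerm φ₂ g) s ∧
      ∀ c ∈ A, NFresh (↑Δ : Set (Atom × Var)) c t → NFresh (↑Δ : Set (Atom × Var)) c s →
        NFresh (pairCtx A Δ φ₁ φ₂) c g := by
  obtain ⟨W, rfl, rfl⟩ := hφ t s
  refine ⟨.susp [] W, .susp (by simp [permBased, permAtoms]) h, ?_, ?_, ?_⟩
  · rw [substTerm_susp, permTerm_nil]; exact .refl _
  · rw [substTerm_susp, permTerm_nil]; exact .refl _
  · exact fun c hc hct hcs => nFresh_susp.2 ⟨hc, hct, hcs⟩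

theorem exists_guide (A : Finset Atom) (Δ : FCtx) (φ₁ φ₂ : NSubst)
    (hφ : ∀ t s, ∃ W, φ₁ W = t ∧ φ₂ W = s) (t s : NTerm) :
    ∃ g, IsGuide A (fun W => ¬ Splits A Δ (φ₁ W) (φ₂ W)) g ∧
      NAlpha (↑Δ : Set (Atom × Var)) (substTerm φ₁ g) t ∧
      NAlpha (↑Δ : Set (Atom × Var)) (substTerm φ₂ g) s ∧
      ∀ c ∈ A, NFresh (↑Δ : Set (Atom × Var)) c t → NFresh (↑Δ : Set (Atom × Var)) c s →
        NFresh (pairCtx A Δ φ₁ φ₂) c g := by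
  suffices H : ∀ (t : NTerm) (ρ : NPerm) (s : NTerm),
      ∃ g, IsGuide A (fun W => ¬ Splits A Δ (φ₁ W) (φ₂ W)) g ∧
        NAlpha (↑Δ : Set (Atom × Var)) (substTerm φ₁ g) (permTerm ρ t) ∧
        NAlpha (↑Δ : Set (Atom × Var)) (substTerm φ₂ g) s ∧
        ∀ c ∈ A, NFresh (↑Δ : Set (Atom × Var)) c (permTerm ρ t) →
          NFresh (↑Δ : Set (Atom × Var)) c s → NFresh (pairCtx A Δ φ₁ φ₂) c g by
    simpa only [permTerm_nil] using H t [] s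
  clear s t
  intro t
  induction t using NTerm.induction with
  | app f ts ih =>
    intro ρ s
    by_cases hsp : Splits A Δ (permTerm ρ (.app f ts)) s
    · rcases hsp with ⟨f', ts', ss, h1, rfl, hl⟩ | ⟨a, h1, -⟩ | ⟨a, t', b, s', h1, -⟩ <;>
        simp only [permTerm_app, NTerm.app.injEq, reduceCtorEq] at h1
      obtain ⟨rfl, rfl⟩ := h1
      simp only [List.length_map] at hl
      choose! G hG using fun t (ht : t ∈ ts) => ih t ht ρ
      have hG' : ∀ p ∈ ts.zip ss, _ := fun p hp => hG p.1 (List.of_mem_zip hp).1 p.2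
      rw [permTerm_app]
      refine ⟨.app f ((ts.zip ss).map fun p => G p.1 p.2), .app ?_, ?_, ?_, ?_⟩
      · intro g hg
        obtain ⟨p, hp, rfl⟩ := List.mem_map.1 hg
        exact (hG' p hp).1
      · rw [substTerm_app, nAlpha_app_iff, List.map_map]
        refine ⟨rfl, ?_⟩
        rw [List.forall₂_iff_get]
        refine ⟨by simp [hl], fun i h1 h2 => ?_⟩
        simp only [List.length_map, List.length_zip, lt_inf_iff] at h1
        have := (hG' (ts[i], ss[i]) (List.mem_iff_getElem.2 ⟨i, by simp [h1], by simp⟩)).2.1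
        simpa using this
      · rw [substTerm_app, nAlpha_app_iff, List.map_map]
        refine ⟨rfl, ?_⟩
        rw [List.forall₂_iff_get]
        refine ⟨by simp [hl], fun i h1 h2 => ?_⟩
        simp only [List.length_map, List.length_zip, lt_inf_iff] at h1
        have := (hG' (ts[i], ss[i]) (List.mem_iff_getElem.2 ⟨i, by simp [h1], by simp⟩)).2.2.1
        simpa using this
      · intro c hc h1 h2
        rw [nFresh_app] at h1 h2 ⊢
        intro g hg
        obtain ⟨p, hp, rfl⟩ := List.mem_map.1 hg
        exact (hG' p hp).2.2.2 c hc (h1 _ (List.mem_map_of_mem (List.of_mem_zip hp).1))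
          (h2 _ (List.of_mem_zip hp).2)
    · exact exists_guide_of_not_splits hφ hsp
  | atom a =>
    intro ρ s
    by_cases hsp : Splits A Δ (permTerm ρ (.atom a)) s
    · rcases hsp with ⟨f', ts', ss, h1, -⟩ | ⟨a, h1, rfl⟩ | ⟨a, t', b, s', h1, -⟩ <;>
        simp only [permTerm_atom, NTerm.atom.injEq, reduceCtorEq] at h1
      subst h1
      rw [permTerm_atom]
      refine ⟨.atom _, .atom, ?_, ?_, fun c _ h _ => .atom (nFresh_atom.1 h)⟩ <;>
      · rw [substTerm_atom]; exact .refl _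
    · exact exists_guide_of_not_splits hφ hsp
  | abs a t ih =>
    intro ρ s
    by_cases hsp : Splits A Δ (permTerm ρ (.abs a t)) s
    · rcases hsp with ⟨f', ts', ss, h1, -⟩ | ⟨a, h1, -⟩ | ⟨a', t', b, s', h1, rfl, c, hc, hct, hcs⟩ <;>
        simp only [permTerm_abs, NTerm.abs.injEq, reduceCtorEq] at h1
      obtain ⟨rfl, rfl⟩ := h1
      obtain ⟨g, hg, hgt, hgs, hgf⟩ := ih ([(c, permAtom ρ a)] ++ ρ) (permTerm [(c, b)] s')
      rw [permTerm_append] at hgt hgf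
      rw [permTerm_abs] at hct ⊢
      refine ⟨.abs c g, .abs hc hg, ?_, ?_, ?_⟩
      · rw [substTerm_abs, nAlpha_abs_iff]; exact ⟨hct, hgt⟩
      · rw [substTerm_abs, nAlpha_abs_iff]; exact ⟨hcs, hgs⟩
      · intro d hd hdt hds
        rw [nFresh_abs]
        by_cases hdc : d = c
        · exact .inl hdc
        · refine .inr (hgf d hd ?_ ?_)
          · exact (nFresh_abs.1 ((nAlpha_abs_iff.2 ⟨hct, .refl _⟩ :
              NAlpha _ (.abs c (permTerm _ _)) _).symm.nFresh hdt)).resolve_left hdc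
          · exact (nFresh_abs.1 ((nAlpha_abs_iff.2 ⟨hcs, .refl _⟩ :
              NAlpha _ (.abs c (permTerm _ _)) _).symm.nFresh hds)).resolve_left hdc
    · exact exists_guide_of_not_splits hφ hsp
  | susp π X =>
    intro ρ s
    have hsp : ¬ Splits A Δ (permTerm ρ (.susp π X)) s := by
      rintro (⟨f', ts', ss, h1, -⟩ | ⟨a, h1, -⟩ | ⟨a', t', b, s', h1, -⟩) <;>
        simp [permTerm_susp] at h1
    exact exists_guide_of_not_splits hφ hsp

/-! ### Guided runs of the algorithm -/

/-- The term `g` is a guide that instantiates to the terms `t` and `s`. -/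
structure Guides (A : Finset Atom) (Δ : FCtx) (φ₁ φ₂ : NSubst) (g t s : NTerm) : Prop where
  based_left : termBased t A
  based_right : termBased s A
  isGuide : IsGuide A (fun W => ¬ Splits A Δ (φ₁ W) (φ₂ W)) g
  left : NAlpha (↑Δ : Set (Atom × Var)) (substTerm φ₁ g) t
  right : NAlpha (↑Δ : Set (Atom × Var)) (substTerm φ₂ g) s

/-- Invariant of guided runs: `κ` assigns a guide to every variable of the state, and turns
the computed instance of `X₀` into the overall guide `g₀`. -/
structure GuidedState (A : Finset Atom) (Δ : FCtx) (φ₁ φ₂ : NSubst) (X₀ : Var) (g₀ : NTerm)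
    (κ : NSubst) (st : NState) : Prop where
  pending : ∀ p ∈ st.P, Guides A Δ φ₁ φ₂ (κ p.1) p.2.1 p.2.2
  stored : ∀ p ∈ st.S, Guides A Δ φ₁ φ₂ (κ p.1) p.2.1 p.2.2
  stored_susp : ∀ p ∈ st.S, ∃ ρ W, κ p.1 = .susp ρ W
  stored_fresh : ∀ p ∈ st.S, ∀ c ∈ A, NFresh (↑Δ : Set (Atom × Var)) c p.2.1 →
    NFresh (↑Δ : Set (Atom × Var)) c p.2.2 → (c, p.1) ∈ st.Γ
  nodup : ((st.P + st.S).map Prod.fst).Nodup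
  mem_used : ∀ Z ∈ (st.P + st.S).map Prod.fst, Z ∈ st.V
  vars : ∀ Z ∈ termVars (st.σ X₀), Z ∈ (st.P + st.S).map Prod.fst
  alpha : NAlpha (pairCtx A Δ φ₁ φ₂) (substTerm κ (st.σ X₀)) g₀

/-- Total size of the guides of the pending triples. -/
noncomputable def guideSize (κ : NSubst) (P : Multiset AUT) : ℕ := (P.map fun p => sizeOf (κ p.1)).sum

theorem guideSize_congr {κ κ' : NSubst} {P : Multiset AUT}
    (h : ∀ p ∈ P, κ' p.1 = κ p.1) : guideSize κ' P = guideSize κ P := by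
  unfold guideSize
  rw [Multiset.map_congr rfl fun p hp => by rw [h p hp]]

theorem nAlpha_updSubst {C : Set (Atom × Var)} {σ κ κ' : NSubst} {X X₀ : Var} {w : NTerm}
    (hw : NAlpha C (substTerm κ' w) (κ X))
    (hκ : ∀ Z ∈ termVars (σ X₀), Z ≠ X → κ' Z = κ Z) :
    NAlpha C (substTerm κ' (updSubst σ X w X₀)) (substTerm κ (σ X₀)) := by
  unfold updSubst substComp
  rw [substTerm_substTerm]
  refine nAlpha_substTerm_congr fun Z hZ => ?_
  unfold substComp
  beta_reduce
  by_cases h : Z = X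
  · simpa [h] using hw
  · rw [if_neg h, substTerm_susp, permTerm_nil, hκ Z hZ h]
    exact .refl _

theorem mem_termVars_updSubst {σ : NSubst} {X X₀ : Var} {w : NTerm} {Z : Var}
    (h : Z ∈ termVars (updSubst σ X w X₀)) :
    Z ∈ termVars w ∨ (Z ≠ X ∧ Z ∈ termVars (σ X₀)) := by
  obtain ⟨Y, hY, hZ⟩ := exists_mem_termVars_of_substTerm h
  split_ifs at hZ with hYX
  · exact .inl hZ
  · simp only [termVars, Finset.mem_singleton] at hZ
    exact .inr ⟨hZ ▸ hYX, hZ ▸ hY⟩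

theorem exists_fresh_list (V : Finset ℕ) (n : ℕ) :
    ∃ Ys : List ℕ, Ys.length = n ∧ Ys.Nodup ∧ ∀ Y ∈ Ys, Y ∉ V := by
  refine ⟨(List.range n).map (· + V.sup id + 1), by simp, ?_, ?_⟩
  · refine List.Nodup.map (fun x y h => ?_) List.nodup_range
    have h' : x + V.sup id + 1 = y + V.sup id + 1 := h
    omega
  · intro Y hY hV
    obtain ⟨i, -, rfl⟩ := List.mem_map.1 hY
    have : i + V.sup id + 1 ≤ V.sup id := Finset.le_sup (f := id) hV
    omega

theorem exists_update_list (κ : NSubst) (Ys : List Var) (gs : List NTerm)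
    (hl : Ys.length = gs.length) (hY : Ys.Nodup) :
    ∃ κ' : NSubst, Ys.map κ' = gs ∧ ∀ Z ∉ Ys, κ' Z = κ Z := by
  induction Ys generalizing gs with
  | nil => exact ⟨κ, by simpa using hl.symm, fun _ _ => rfl⟩
  | cons Y Ys ih =>
    cases gs with
    | nil => simp at hl
    | cons g gs =>
      rw [List.nodup_cons] at hY
      obtain ⟨κ', h1, h2⟩ := ih gs (by simpa using hl) hY.2
      refine ⟨Function.update κ' Y g, ?_, fun Z hZ => ?_⟩
      · rw [List.map_cons, Function.update_self, ← h1]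
        congr 1
        exact List.map_congr_left fun Z hZ =>
          Function.update_of_ne (by rintro rfl; exact hY.1 hZ) _ _
      · rw [List.mem_cons, not_or] at hZ
        rw [Function.update_of_ne hZ.1, h2 Z hZ.2]

theorem sum_map_sizeOf_le (gs : List NTerm) : (gs.map sizeOf).sum ≤ sizeOf gs := by
  induction gs with
  | nil => simp
  | cons g gs ih => simp; omega

section GuidedRun

variable {A : Finset Atom} {Δ : FCtx} {φ₁ φ₂ : NSubst} {X₀ : Var} {g₀ : NTerm} {κ : NSubst}
  {P S : Multiset AUT} {Γ : FCtx} {σ : NSubst} {V : Finset Var} {X : Var} {t s : NTerm}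

theorem GuidedState.exists_decApp {f : Fn} {gs : List NTerm}
    (h : GuidedState A Δ φ₁ φ₂ X₀ g₀ κ ⟨(X, t, s) ::ₘ P, S, Γ, σ, V⟩)
    (hX : κ X = .app f gs) :
    ∃ st κ', NStep A Δ ⟨(X, t, s) ::ₘ P, S, Γ, σ, V⟩ st ∧
      GuidedState A Δ φ₁ φ₂ X₀ g₀ κ' st ∧
      guideSize κ' st.P < guideSize κ ((X, t, s) ::ₘ P) := by
  obtain ⟨hbt, hbs, hg, ht, hs⟩ := h.pending (X, t, s) (Multiset.mem_cons_self _ _)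
  simp only [hX, substTerm_app] at hbt hbs hg ht hs
  cases t <;> try (cases ht; done)
  cases s <;> try (cases hs; done)
  rename_i f₁ ts f₂ ss
  rw [nAlpha_app_iff] at ht hs
  obtain ⟨rfl, ht⟩ := ht
  obtain ⟨rfl, hs⟩ := hs
  rw [List.forall₂_iff_get] at ht hs
  obtain ⟨hlt, ht⟩ := ht
  obtain ⟨hls, hs⟩ := hs
  rw [List.length_map] at hlt hls
  rw [termBased_app] at hbt hbs
  have hg : ∀ g ∈ gs, IsGuide A (fun W => ¬ Splits A Δ (φ₁ W) (φ₂ W)) g := by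
    cases hg; assumption
  obtain ⟨Ys, hYl, hYn, hYV⟩ := exists_fresh_list V ts.length
  obtain ⟨κ', hκY, hκ⟩ := exists_update_list κ Ys gs (hYl.trans hlt.symm) hYn
  have hold : ∀ Z ∈ V, κ' Z = κ Z := fun Z hZ => hκ Z fun h => hYV Z h hZ
  have hfst : (List.zipWith (fun Y p => (Y, p)) Ys (List.zip ts ss)).map Prod.fst = Ys := by
    change (List.zip Ys (List.zip ts ss)).map Prod.fst = Ys
    exact List.map_fst_zip (by simp; omega)
  have hused := h.mem_used
  have hnodup := h.nodup
  have hvars := h.vars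
  simp only [Multiset.cons_add, Multiset.map_cons, Multiset.nodup_cons,
    Multiset.mem_cons] at hused hnodup hvars
  have husedP : ∀ p ∈ P, p.1 ∈ V := fun p hp =>
    hused _ (.inr (Multiset.mem_map_of_mem _ (Multiset.mem_add.2 (.inl hp))))
  have husedS : ∀ p ∈ S, p.1 ∈ V := fun p hp =>
    hused _ (.inr (Multiset.mem_map_of_mem _ (Multiset.mem_add.2 (.inr hp))))
  refine ⟨_, κ', .decApp Ys (by omega) hYl hYn hYV, ⟨?_, ?_, ?_, ?_, ?_, ?_, ?_, ?_⟩, ?_⟩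
  · intro p hp
    rcases Multiset.mem_add.1 hp with hp | hp
    · rw [Multiset.mem_coe] at hp
      obtain ⟨i, hi, rfl⟩ := List.mem_iff_getElem.1 hp
      simp only [List.length_zipWith, List.length_zip, lt_inf_iff] at hi
      simp only [List.getElem_zipWith, List.getElem_zip]
      have hgi : κ' Ys[i] = gs[i]'(by omega) := by simp [← hκY]
      rw [hgi]
      exact ⟨hbt _ (List.getElem_mem _), hbs _ (List.getElem_mem _), hg _ (List.getElem_mem _),
        by simpa using ht i (by simp; omega) hi.2.1, by simpa using hs i (by simp; omega) hi.2.2⟩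
    · rw [hold _ (husedP p hp)]
      exact h.pending p (Multiset.mem_cons_of_mem hp)
  · intro p hp
    rw [hold _ (husedS p hp)]
    exact h.stored p hp
  · intro p hp
    rw [hold _ (husedS p hp)]
    exact h.stored_susp p hp
  · exact h.stored_fresh
  · simp only [Multiset.map_add, Multiset.map_coe, hfst, add_assoc]
    rw [Multiset.nodup_add, ← Multiset.map_add]
    refine ⟨by simpa using hYn, hnodup.2, ?_⟩
    rw [Multiset.disjoint_left]
    exact fun hZ hZ' => hYV _ (by simpa using hZ) (hused _ (.inr hZ'))
  · simp only [Multiset.map_add, Multiset.map_coe, hfst, add_assoc]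
    intro Z hZ
    rw [← Multiset.map_add, Multiset.mem_add] at hZ
    rcases hZ with hZ | hZ
    · exact Finset.mem_union_right _ (by simpa using hZ)
    · exact Finset.mem_union_left _ (hused _ (.inr hZ))
  · simp only [Multiset.map_add, Multiset.map_coe, hfst, add_assoc]
    intro Z hZ
    rw [← Multiset.map_add, Multiset.mem_add]
    rcases mem_termVars_updSubst hZ with hZ | ⟨hZX, hZ⟩
    · left
      rw [mem_termVars_app] at hZ
      obtain ⟨u, hu, hZ⟩ := hZ
      obtain ⟨Y, hY, rfl⟩ := List.mem_map.1 hu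
      simp only [termVars, Finset.mem_singleton] at hZ
      simpa [hZ] using hY
    · exact .inr ((hvars Z hZ).resolve_left hZX)
  · refine .trans (nAlpha_updSubst (κ := κ) ?_ ?_) h.alpha
    · rw [hX, substTerm_app, List.map_map, ← hκY]
      have : (substTerm κ' ∘ fun Y => NTerm.susp [] Y) = κ' := by
        funext Y; simp [substTerm_susp, permTerm_nil]
      rw [this]
      exact .refl _
    · exact fun Z hZ _ => hold Z (hused _ (hvars Z hZ))
  · have h1 : guideSize κ' P = guideSize κ P :=
      guideSize_congr fun p hp => hold _ (husedP p hp)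
    have h2 : guideSize κ' ↑(List.zipWith (fun Y p => (Y, p)) Ys (List.zip ts ss)) =
        (gs.map sizeOf).sum := by
      unfold guideSize
      rw [← hκY, Multiset.map_coe, Multiset.sum_coe, List.map_map]
      conv_rhs => rw [← hfst]
      rw [List.map_map]
      rfl
    have h3 := sum_map_sizeOf_le gs
    unfold guideSize at h1 h2 ⊢
    simp only [Multiset.map_add, Multiset.sum_add, Multiset.map_cons, Multiset.sum_cons, h1, h2, hX,
      NTerm.app.sizeOf_spec]
    omega

theorem GuidedState.exists_decAtom {a : Atom}
    (h : GuidedState A Δ φ₁ φ₂ X₀ g₀ κ ⟨(X, t, s) ::ₘ P, S, Γ, σ, V⟩)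
    (hX : κ X = .atom a) :
    ∃ st κ', NStep A Δ ⟨(X, t, s) ::ₘ P, S, Γ, σ, V⟩ st ∧
      GuidedState A Δ φ₁ φ₂ X₀ g₀ κ' st ∧
      guideSize κ' st.P < guideSize κ ((X, t, s) ::ₘ P) := by
  obtain ⟨-, -, -, ht, hs⟩ := h.pending (X, t, s) (Multiset.mem_cons_self _ _)
  simp only [hX, substTerm_atom] at ht hs
  cases ht
  cases hs
  have hused := h.mem_used
  have hnodup := h.nodup
  have hvars := h.vars
  simp only [Multiset.cons_add, Multiset.map_cons, Multiset.nodup_cons,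
    Multiset.mem_cons] at hused hnodup hvars
  refine ⟨_, κ, .decAtom, ⟨fun p hp => h.pending p (Multiset.mem_cons_of_mem hp), h.stored,
    h.stored_susp, h.stored_fresh, hnodup.2, fun Z hZ => hused Z (.inr hZ), ?_, ?_⟩, ?_⟩
  · intro Z hZ
    rcases mem_termVars_updSubst hZ with hZ | ⟨hZX, hZ⟩
    · simp [termVars] at hZ
    · exact (hvars Z hZ).resolve_left hZX
  · refine .trans (nAlpha_updSubst (κ := κ) ?_ fun _ _ _ => rfl) h.alpha
    rw [hX, substTerm_atom]
    exact .refl _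
  · simp [guideSize, hX]

theorem GuidedState.exists_abs {c : Atom} {g : NTerm}
    (h : GuidedState A Δ φ₁ φ₂ X₀ g₀ κ ⟨(X, t, s) ::ₘ P, S, Γ, σ, V⟩)
    (hX : κ X = .abs c g) :
    ∃ st κ', NStep A Δ ⟨(X, t, s) ::ₘ P, S, Γ, σ, V⟩ st ∧
      GuidedState A Δ φ₁ φ₂ X₀ g₀ κ' st ∧
      guideSize κ' st.P < guideSize κ ((X, t, s) ::ₘ P) := by
  obtain ⟨hbt, hbs, hg, ht, hs⟩ := h.pending (X, t, s) (Multiset.mem_cons_self _ _)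
  simp only [hX, substTerm_abs] at hbt hbs hg ht hs
  cases t <;> try (cases ht; done)
  cases s <;> try (cases hs; done)
  rename_i a t b s
  rw [nAlpha_abs_iff] at ht hs
  rw [termBased_abs] at hbt hbs
  have hg : c ∈ A ∧ IsGuide A (fun W => ¬ Splits A Δ (φ₁ W) (φ₂ W)) g := by
    cases hg; constructor <;> assumption
  obtain ⟨Ys, hYl, hYn, hYV⟩ := exists_fresh_list V 1
  obtain ⟨Y, rfl⟩ := List.length_eq_one_iff.1 hYl
  replace hYV : Y ∉ V := hYV Y (by simp)
  have hold : ∀ Z ∈ V, Function.update κ Y g Z = κ Z := fun Z hZ =>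
    Function.update_of_ne (by rintro rfl; exact hYV hZ) _ _
  have hused := h.mem_used
  have hnodup := h.nodup
  have hvars := h.vars
  simp only [Multiset.cons_add, Multiset.map_cons, Multiset.nodup_cons,
    Multiset.mem_cons] at hused hnodup hvars
  have husedP : ∀ p ∈ P, p.1 ∈ V := fun p hp =>
    hused _ (.inr (Multiset.mem_map_of_mem _ (Multiset.mem_add.2 (.inl hp))))
  have husedS : ∀ p ∈ S, p.1 ∈ V := fun p hp =>
    hused _ (.inr (Multiset.mem_map_of_mem _ (Multiset.mem_add.2 (.inr hp))))
  have hbased : ∀ {d}, d ∈ A → permBased [(c, d)] A := fun hd => by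
    simp [permBased, permAtoms, Finset.insert_subset_iff, hg.1, hd]
  refine ⟨_, Function.update κ Y g, .abs Y c hYV hg.1 ht.1 hs.1,
    ⟨?_, ?_, ?_, h.stored_fresh, ?_, ?_, ?_, ?_⟩, ?_⟩
  · intro p hp
    rcases Multiset.mem_cons.1 hp with rfl | hp
    · simp only [Function.update_self]
      exact ⟨termBased_permTerm (hbased hbt.1) hbt.2, termBased_permTerm (hbased hbs.1) hbs.2,
        hg.2, ht.2, hs.2⟩
    · rw [hold _ (husedP p hp)]
      exact h.pending p (Multiset.mem_cons_of_mem hp)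
  · intro p hp
    rw [hold _ (husedS p hp)]
    exact h.stored p hp
  · intro p hp
    rw [hold _ (husedS p hp)]
    exact h.stored_susp p hp
  · simp only [Multiset.cons_add, Multiset.map_cons, Multiset.nodup_cons]
    exact ⟨fun hY => hYV (hused _ (.inr hY)), hnodup.2⟩
  · simp only [Multiset.cons_add, Multiset.map_cons, Multiset.mem_cons, Finset.mem_insert]
    exact fun Z hZ => hZ.imp_right fun hZ => hused _ (.inr hZ)
  · simp only [Multiset.cons_add, Multiset.map_cons, Multiset.mem_cons]
    intro Z hZ
    rcases mem_termVars_updSubst hZ with hZ | ⟨hZX, hZ⟩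
    · exact .inl (by simpa [termVars] using hZ)
    · exact .inr ((hvars Z hZ).resolve_left hZX)
  · refine .trans (nAlpha_updSubst (κ := κ) ?_ ?_) h.alpha
    · rw [hX, substTerm_abs, substTerm_susp, permTerm_nil, Function.update_self]
      exact .refl _
    · exact fun Z hZ _ => hold Z (hused _ (hvars Z hZ))
  · have h1 : guideSize (Function.update κ Y g) P = guideSize κ P :=
      guideSize_congr fun p hp => hold _ (husedP p hp)
    unfold guideSize at h1 ⊢
    simp only [Multiset.map_cons, Multiset.sum_cons, h1, hX, Function.update_self,
      NTerm.abs.sizeOf_spec]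
    omega

theorem Guides.solCond {ρ : NPerm} {W : Var}
    (h : Guides A Δ φ₁ φ₂ (.susp ρ W) t s) : SolCond A Δ t s := by
  obtain ⟨-, -, hg, ht, hs⟩ := h
  rw [substTerm_susp] at ht hs
  cases hg with
  | susp hρ hW => exact solCond_of_not_splits fun hsp => hW (hsp.of_permTerm hρ ht hs)

theorem GuidedState.exists_sol {ρ : NPerm} {W : Var}
    (h : GuidedState A Δ φ₁ φ₂ X₀ g₀ κ ⟨(X, t, s) ::ₘ P, S, Γ, σ, V⟩)
    (hX : κ X = .susp ρ W) :
    ∃ st κ', NStep A Δ ⟨(X, t, s) ::ₘ P, S, Γ, σ, V⟩ st ∧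
      GuidedState A Δ φ₁ φ₂ X₀ g₀ κ' st ∧
      guideSize κ' st.P < guideSize κ ((X, t, s) ::ₘ P) := by
  have hp := h.pending (X, t, s) (Multiset.mem_cons_self _ _)
  have hperm : P + (X, t, s) ::ₘ S = (X, t, s) ::ₘ P + S := by
    rw [Multiset.add_cons, Multiset.cons_add]
  refine ⟨_, κ, .sol (hX ▸ hp : Guides A Δ φ₁ φ₂ _ t s).solCond,
    ⟨fun p hp => h.pending p (Multiset.mem_cons_of_mem hp), ?_, ?_, ?_, ?_, ?_, ?_, h.alpha⟩, ?_⟩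
  · intro q hq
    rcases Multiset.mem_cons.1 hq with rfl | hq
    · exact hp
    · exact h.stored q hq
  · intro q hq
    rcases Multiset.mem_cons.1 hq with rfl | hq
    · exact ⟨ρ, W, hX⟩
    · exact h.stored_susp q hq
  · intro q hq c hc h1 h2
    rcases Multiset.mem_cons.1 hq with rfl | hq
    · exact Finset.mem_union_right _ (by simp [solSet, hc, h1, h2])
    · exact Finset.mem_union_left _ (h.stored_fresh q hq c hc h1 h2)
  · simpa only [hperm] using h.nodup
  · simpa only [hperm] using h.mem_used
  · simpa only [hperm] using h.vars
  · simp [guideSize, hX]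

theorem GuidedState.exists_solved {st : NState} (h : GuidedState A Δ φ₁ φ₂ X₀ g₀ κ st) :
    ∃ st' κ', Relation.ReflTransGen (NStep A Δ) st st' ∧
      GuidedState A Δ φ₁ φ₂ X₀ g₀ κ' st' ∧ st'.P = 0 := by
  induction hn : guideSize κ st.P using Nat.strong_induction_on generalizing κ st with
  | _ n ih =>
    obtain ⟨P, S, Γ, σ, V⟩ := st
    rcases Multiset.empty_or_exists_mem P with rfl | ⟨p, hp⟩
    · exact ⟨_, κ, .refl, h, rfl⟩
    · obtain ⟨P, rfl⟩ := Multiset.exists_cons_of_mem hp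
      obtain ⟨X, t, s⟩ := p
      obtain ⟨st', κ', hstep, h', hlt⟩ : ∃ st κ',
          NStep A Δ ⟨(X, t, s) ::ₘ P, S, Γ, σ, V⟩ st ∧
          GuidedState A Δ φ₁ φ₂ X₀ g₀ κ' st ∧
          guideSize κ' st.P < guideSize κ ((X, t, s) ::ₘ P) := by
        cases hX : κ X with
        | app f gs => exact h.exists_decApp hX
        | atom a => exact h.exists_decAtom hX
        | abs c g => exact h.exists_abs hX
        | susp ρ W => exact h.exists_sol hX
      obtain ⟨st'', κ'', hsteps, h'', hP⟩ := ih _ (hn ▸ hlt) h' rfl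
      exact ⟨st'', κ'', .head hstep hsteps, h'', hP⟩

theorem GuidedState.exists_mer {Y : Var} {t₁ s₁ t₂ s₂ : NTerm} {ρ₁ ρ₂ : NPerm} {W : Var}
    (h : GuidedState A Δ φ₁ φ₂ X₀ g₀ κ ⟨0, (X, t₁, s₁) ::ₘ (Y, t₂, s₂) ::ₘ S, Γ, σ, V⟩)
    (hX : κ X = .susp ρ₁ W) (hY : κ Y = .susp ρ₂ W) :
    ∃ Γ' σ', NStep A Δ ⟨0, (X, t₁, s₁) ::ₘ (Y, t₂, s₂) ::ₘ S, Γ, σ, V⟩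
        ⟨0, (X, t₁, s₁) ::ₘ S, Γ', σ', V⟩ ∧
      GuidedState A Δ φ₁ φ₂ X₀ g₀ κ ⟨0, (X, t₁, s₁) ::ₘ S, Γ', σ', V⟩ := by
  have h1 := h.stored (X, t₁, s₁) (by simp)
  have h2 := h.stored (Y, t₂, s₂) (by simp)
  simp only [hX, hY] at h1 h2
  obtain ⟨hbt₁, hbs₁, hg₁, ht₁, hs₁⟩ := h1
  obtain ⟨hbt₂, hbs₂, hg₂, ht₂, hs₂⟩ := h2
  rw [substTerm_susp] at ht₁ hs₁ ht₂ hs₂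
  have hρ₁ : permBased ρ₁ A := by cases hg₁; assumption
  have hρ₂ : permBased ρ₂ A := by cases hg₂; assumption
  have link : ∀ {u t t' : NTerm}, NAlpha (↑Δ : Set (Atom × Var)) (permTerm ρ₁ u) t →
      NAlpha (↑Δ : Set (Atom × Var)) (permTerm ρ₂ u) t' →
      NAlpha (↑Δ : Set (Atom × Var)) (permTerm (ρ₂ ++ permInv ρ₁) t) t' := by
    intro u t t' h h'
    rw [permTerm_append]
    exact (((h.symm.permTerm _).trans (nAlpha_permInv_permTerm _ _)).permTerm _).trans h'
  obtain ⟨π, hπ, hπt, hπs⟩ := exists_permBased_nAlpha (link ht₁ ht₂) (link hs₁ hs₂)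
  have hπA : permBased π A := hπ.trans
    (Finset.union_subset (Finset.union_subset (Finset.union_subset hbt₁ hbs₁) hbt₂) hbs₂)
  have hused := h.mem_used
  have hnodup := h.nodup
  have hvars := h.vars
  simp only [zero_add, Multiset.map_cons, Multiset.nodup_cons, Multiset.mem_cons,
    not_or] at hused hnodup hvars
  have hne : ∀ q ∈ (X, t₁, s₁) ::ₘ S, q.1 ≠ Y := by
    intro q hq
    rcases Multiset.mem_cons.1 hq with rfl | hq
    · exact hnodup.1.1
    · exact fun hqY => hnodup.2.1 (hqY ▸ Multiset.mem_map_of_mem _ hq)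
  have hsub : ∀ q ∈ (X, t₁, s₁) ::ₘ S, q ∈ (X, t₁, s₁) ::ₘ (Y, t₂, s₂) ::ₘ S := by
    intro q hq
    simp only [Multiset.mem_cons] at hq ⊢
    tauto
  refine ⟨_, _, .mer π hnodup.1.1 hπ hπt hπs, ⟨by simp, fun q hq => h.stored q (hsub q hq),
    fun q hq => h.stored_susp q (hsub q hq), ?_, ?_, ?_, ?_, ?_⟩⟩
  · intro q hq c hc hc1 hc2
    exact Finset.mem_image.2
      ⟨_, h.stored_fresh q (hsub q hq) c hc hc1 hc2, by simp [hne q hq]⟩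
  · simp only [zero_add, Multiset.map_cons, Multiset.nodup_cons]
    exact ⟨hnodup.1.2, hnodup.2.2⟩
  · simp only [zero_add, Multiset.map_cons, Multiset.mem_cons]
    exact fun Z hZ => hused Z (hZ.imp_right .inr)
  · simp only [zero_add, Multiset.map_cons, Multiset.mem_cons]
    intro Z hZ
    rcases mem_termVars_updSubst hZ with hZ | ⟨hZY, hZ⟩
    · exact .inl (by simpa [termVars] using hZ)
    · rcases hvars Z hZ with h | h | h
      · exact .inl h
      · exact absurd h hZY
      · exact .inr h
  · refine .trans (nAlpha_updSubst (κ := κ) ?_ fun _ _ _ => rfl) h.alpha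
    rw [substTerm_susp, hX, hY, permTerm_susp]
    refine .susp fun a ha => ?_
    rw [permAtom_append] at ha
    have fresh : ∀ {u t t' : NTerm}, NAlpha (↑Δ : Set (Atom × Var)) (permTerm ρ₁ u) t →
        NAlpha (↑Δ : Set (Atom × Var)) (permTerm ρ₂ u) t' →
        NAlpha (↑Δ : Set (Atom × Var)) (permTerm π t) t' →
        NFresh (↑Δ : Set (Atom × Var)) a u := by
      intro u t t' h h' hπ
      by_contra hf
      have := ((h.permTerm π).trans (hπ.trans h'.symm)).den_eq id
      rw [den_permTerm, den_permTerm, den_permTerm, den_eq_den_iff] at this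
      exact ha (this a hf)
    refine ⟨?_, fresh ht₁ ht₂ hπt, fresh hs₁ hs₂ hπs⟩
    by_contra haA
    simp only at haA
    rw [permAtom_of_notMem ρ₁ a fun h => haA (hρ₁ h), permAtom_of_notMem π a fun h => haA (hπA h),
      permAtom_of_notMem ρ₂ a fun h => haA (hρ₂ h)] at ha
    exact ha rfl

theorem GuidedState.exists_merged
    (h : GuidedState A Δ φ₁ φ₂ X₀ g₀ κ ⟨0, S, Γ, σ, V⟩) :
    ∃ S' Γ' σ', Relation.ReflTransGen (NStep A Δ) ⟨0, S, Γ, σ, V⟩ ⟨0, S', Γ', σ', V⟩ ∧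
      GuidedState A Δ φ₁ φ₂ X₀ g₀ κ ⟨0, S', Γ', σ', V⟩ ∧
      ∀ p ∈ S', ∀ q ∈ S', ∀ ρ₁ ρ₂ W, κ p.1 = .susp ρ₁ W → κ q.1 = .susp ρ₂ W →
        p.1 = q.1 := by
  induction hn : Multiset.card S generalizing S Γ σ with
  | zero =>
    rw [Multiset.card_eq_zero] at hn
    subst hn
    exact ⟨_, _, _, .refl, h, by simp⟩
  | succ n ih =>
    by_cases hm : ∀ p ∈ S, ∀ q ∈ S, ∀ ρ₁ ρ₂ W, κ p.1 = .susp ρ₁ W → κ q.1 = .susp ρ₂ W →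
        p.1 = q.1
    · exact ⟨_, _, _, .refl, h, hm⟩
    · push Not at hm
      obtain ⟨p, hp, q, hq, ρ₁, ρ₂, W, hκp, hκq, hpq⟩ := hm
      obtain ⟨S, rfl⟩ := Multiset.exists_cons_of_mem hp
      have hq := (Multiset.mem_cons.1 hq).resolve_left fun h => hpq (h ▸ rfl)
      obtain ⟨S, rfl⟩ := Multiset.exists_cons_of_mem hq
      obtain ⟨Γ', σ', hstep, h'⟩ := h.exists_mer hκp hκq
      obtain ⟨S'', Γ'', σ'', hsteps, h''⟩ := ih h' (by simpa using hn)
      exact ⟨S'', Γ'', σ'', .head hstep hsteps, h''⟩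

/-- In a fully merged state the guide variables can be mapped to the store variables. -/
theorem GuidedState.exists_subst (h : GuidedState A Δ φ₁ φ₂ X₀ g₀ κ ⟨0, S, Γ, σ, V⟩)
    (hm : ∀ p ∈ S, ∀ q ∈ S, ∀ ρ₁ ρ₂ W, κ p.1 = .susp ρ₁ W → κ q.1 = .susp ρ₂ W →
      p.1 = q.1) :
    ∃ θ : NSubst,
      (∀ c W, (c, W) ∈ pairCtx A Δ φ₁ φ₂ → NFresh (↑Γ : Set (Atom × Var)) c (θ W)) ∧
      NAlpha (↑Γ : Set (Atom × Var)) (substTerm θ g₀) (σ X₀) := by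
  have hθ : ∀ W, ∃ u, (∀ p ∈ S, ∀ ρ, κ p.1 = .susp ρ W → u = .susp (permInv ρ) p.1) ∧
      ∀ c, (c, W) ∈ pairCtx A Δ φ₁ φ₂ → NFresh (↑Γ : Set (Atom × Var)) c u := by
    intro W
    by_cases hW : ∃ p ∈ S, ∃ ρ, κ p.1 = .susp ρ W
    · obtain ⟨p, hp, ρ, hκ⟩ := hW
      refine ⟨.susp (permInv ρ) p.1, ?_, ?_⟩
      · intro q hq ρ' hκ'
        have hpq := hm p hp q hq ρ ρ' W hκ hκ'
        rw [← hpq, hκ] at hκ'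
        cases hκ'
        rw [hpq]
      · rintro c ⟨hc, hc1, hc2⟩
        obtain ⟨-, -, hg, ht, hs⟩ := h.stored p hp
        rw [hκ] at hg ht hs
        rw [substTerm_susp] at ht hs
        have hρ : permBased ρ A := by cases hg; assumption
        rw [nFresh_susp, permInv_permInv]
        refine h.stored_fresh p hp _ (permAtom_mem hρ hc) (ht.nFresh ?_) (hs.nFresh ?_) <;>
        · rw [nFresh_permTerm, permAtom_permInv_left]; assumption
    · exact ⟨.app 0 [], fun p hp ρ hκ => absurd ⟨p, hp, ρ, hκ⟩ hW, fun c _ => .app (by simp)⟩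
  choose θ hθ hfresh using hθ
  have hfresh' : ∀ c W, (c, W) ∈ pairCtx A Δ φ₁ φ₂ → NFresh (↑Γ : Set (Atom × Var)) c (θ W) :=
    fun c W => hfresh W c
  refine ⟨θ, hfresh', (h.alpha.substTerm hfresh').symm.trans ?_⟩
  rw [substTerm_substTerm]
  conv_rhs => rw [← substTerm_idSubst (σ X₀)]
  refine nAlpha_substTerm_congr fun Z hZ => ?_
  have := h.vars Z hZ
  rw [zero_add] at this
  obtain ⟨p, hp, rfl⟩ := Multiset.mem_map.1 this
  obtain ⟨ρ, W, hκ⟩ := h.stored_susp p hp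
  rw [substComp, hκ, substTerm_susp, hθ W p hp ρ hκ, permTerm_susp, idSubst]
  refine .susp fun a ha => absurd ?_ ha
  rw [permAtom_append, permAtom_permInv_right]
  rfl

end GuidedRun

theorem exists_pair_enumeration :
    ∃ φ₁ φ₂ : NSubst, ∀ t s, ∃ W, φ₁ W = t ∧ φ₂ W = s := by
  have : Countable NTerm := NTerm.code_injective.countable
  have : Nonempty NTerm := ⟨.atom 0⟩
  obtain ⟨f, hf⟩ := exists_surjective_nat (NTerm × NTerm)
  refine ⟨fun W => (f W).1, fun W => (f W).2, fun t s => ?_⟩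
  obtain ⟨W, hW⟩ := hf (t, s)
  exact ⟨W, by simp [hW], by simp [hW]⟩

/-- completeness of the nominal anti-unification algorithm 𝔑: for
every `A`-based generalization `⟨Γ, r⟩` of `⟨Δ, t⟩` and `⟨Δ, s⟩` there is a
derivation of 𝔑 from `{X : t ≜ s}; ∅; ∅; ε` to a state `∅; S; Γ'; σ` such that
`⟨Γ, r⟩ ⪯ ⟨Γ', Xσ⟩`. -/
theorem nau_completeness (A : Finset Atom) (Δ Γ : FCtx) (t s r : NTerm) (X : Var)
    (ht : termBased t A) (hs : termBased s A) (hΔ : ctxBased Δ A)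
    (hΓ : ctxBased Γ A) (hr : termBased r A)
    (hgen : IsGen (Γ, r) (Δ, t) (Δ, s)) :
    ∃ (S : Multiset AUT) (Γ' : FCtx) (σ : NSubst) (V : Finset Var),
      Relation.TransGen (NStep A Δ) (initNState X t s Δ) ⟨0, S, Γ', σ, V⟩ ∧
      TIC.Le (Γ, r) (Γ', σ X) := by
  obtain ⟨⟨σ₁, -, hf₁, ha₁⟩, ⟨σ₂, -, hf₂, ha₂⟩⟩ := hgen
  obtain ⟨φ₁, φ₂, hφ⟩ := exists_pair_enumeration
  choose γ hγ hγ₁ hγ₂ hγf using fun Z => exists_guide A Δ φ₁ φ₂ hφ (σ₁ Z) (σ₂ Z)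
  have hinst : ∀ {φ τ : NSubst} {u : NTerm},
      (∀ Z, NAlpha (↑Δ : Set (Atom × Var)) (substTerm φ (γ Z)) (τ Z)) →
      NAlpha (↑Δ : Set (Atom × Var)) (substTerm τ r) u →
      NAlpha (↑Δ : Set (Atom × Var)) (substTerm φ (substTerm γ r)) u := by
    intro φ τ u h hu
    rw [substTerm_substTerm]
    exact (nAlpha_substTerm_congr fun Z _ => h Z).trans hu
  have hinit : GuidedState A Δ φ₁ φ₂ X (substTerm γ r) (fun _ => substTerm γ r)
      (initNState X t s Δ) := by
    refine ⟨?_, by simp [initNState], by simp [initNState], by simp [initNState],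
      by simp [initNState], by simp [initNState], by simp [initNState, idSubst, termVars], ?_⟩
    · intro p hp
      rw [initNState, Multiset.mem_singleton] at hp
      subst hp
      exact ⟨ht, hs, isGuide_substTerm hγ hr, hinst hγ₁ ha₁, hinst hγ₂ ha₂⟩
    · simp only [initNState, idSubst, substTerm_susp, permTerm_nil]
      exact .refl _
  obtain ⟨⟨P, S, Γ', σ, V⟩, κ, hsteps, hst, rfl⟩ := hinit.exists_solved
  obtain ⟨S', Γ'', σ', hsteps', hst', hm⟩ := hst.exists_merged
  obtain ⟨θ, hθf, hθ⟩ := hst'.exists_subst hm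
  refine ⟨S', Γ'', σ', V, ?_, substComp γ θ, ?_, ?_, ?_⟩
  · rcases Relation.reflTransGen_iff_eq_or_transGen.1 (hsteps.trans hsteps') with h | h
    · simp [initNState] at h
    · exact h
  all_goals
    have hfresh : ∀ a Z, (a, Z) ∈ Γ →
        NFresh (↑Γ'' : Set (Atom × Var)) a (substComp γ θ Z) := fun a Z haZ =>
      (hγf Z a (hΓ (Finset.mem_image_of_mem Prod.fst haZ)) (hf₁ _ haZ) (hf₂ _ haZ)).substTerm hθf
  · exact fun a Z haZ => (hfresh a Z haZ).notMem_FAnoSusp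
  · exact fun c hc => hfresh c.1 c.2 hc
  · rw [← substTerm_substTerm]
    exact hθ
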